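/- arXiv:1210.1102 — 3 statements merged into one kernel-verified Lean document; each statement's English description precedes it below -/
import Mathlib

section
/- Let n ∈ ℕ, q ∈ (0,1], and let 𝓒 denote one of the classes 𝓡̄_n(q), 𝓡_n(q), 𝓝̄_n(q), 𝓝_n(q). Then F ∈ 𝓒 implies Δ*_{q,n}[F] ∈ 𝓒. -/
open Polynomial Filter

open scoped Classical

noncomputable section

/-- `R_n(q;z) = ∏_{j=1}^n (1 + q^{j-1} z)`, the generating polynomial of the
q-binomial coefficients. -/
def Rpoly (n : ℕ) (q : ℝ) : Polynomial ℝ :=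
  ∏ j ∈ Finset.range n, (1 + Polynomial.C (q ^ j) * Polynomial.X)

/-- The q-binomial coefficient `C_k^n(q)`. -/
def qBinom (n k : ℕ) (q : ℝ) : ℝ := (Rpoly n q).coeff k

/-- The weighted Hadamard product `F *_q^n G`: if `F = ∑ C_k^n(q) a_k z^k` and
`G = ∑ C_k^n(q) b_k z^k`, then `F *_q^n G = ∑ C_k^n(q) a_k b_k z^k`. -/
def qHadamard (n : ℕ) (q : ℝ) (F G : Polynomial ℝ) : Polynomial ℝ :=
  ∑ k ∈ Finset.range (n + 1),
    Polynomial.C (F.coeff k * G.coeff k / qBinom n k q) * Polynomial.X ^ k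

/-- All zeros of the real polynomial `F` are real (it splits over `ℝ`). -/
def RealRooted (F : Polynomial ℝ) : Prop :=
  F = 0 ∨ F.roots.card = F.natDegree

/-- All real roots of `F` are nonpositive. -/
def OnlyNonposRoots (F : Polynomial ℝ) : Prop := ∀ x ∈ F.roots, x ≤ 0

/-- The multiset `s` (of zeros, with multiplicity) is logarithmically q-separated. -/
def LogSep (q : ℝ) (s : Multiset ℝ) : Prop :=
  (∀ x ∈ s, x ≠ 0 → 2 ≤ s.count x → (1 : ℝ) ≤ q) ∧
  (∀ x ∈ s, ∀ y ∈ s, ((y < x ∧ x < 0) ∨ (0 < x ∧ x < y)) → x / y ≤ q)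

/-- The multiset `s` (of zeros, with multiplicity) is strictly logarithmically
q-separated. -/
def StrictLogSep (q : ℝ) (s : Multiset ℝ) : Prop :=
  (∀ x ∈ s, x ≠ 0 → 2 ≤ s.count x → (1 : ℝ) < q) ∧
  (∀ x ∈ s, ∀ y ∈ s, ((y < x ∧ x < 0) ∨ (0 < x ∧ x < y)) → x / y < q)

/-- The class `𝓡̄_n(q)`. -/
def memRbar (n : ℕ) (q : ℝ) (F : Polynomial ℝ) : Prop :=
  F.natDegree ≤ n ∧ RealRooted F ∧ LogSep q F.roots

/-- The class `𝓡_n(q)`. -/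
def memR (n : ℕ) (q : ℝ) (F : Polynomial ℝ) : Prop :=
  F.natDegree ≤ n ∧ RealRooted F ∧ StrictLogSep q F.roots

/-- The class `𝓝̄_n(q)`. -/
def memNbar (n : ℕ) (q : ℝ) (F : Polynomial ℝ) : Prop :=
  memRbar n q F ∧ OnlyNonposRoots F

/-- The class `𝓝_n(q)`. -/
def memN (n : ℕ) (q : ℝ) (F : Polynomial ℝ) : Prop :=
  memR n q F ∧ OnlyNonposRoots F

/-- `F ≼ G` : both have only real zeros and `F'G - FG' ≤ 0` on `ℝ`. -/
def Prec (F G : Polynomial ℝ) : Prop :=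
  RealRooted F ∧ RealRooted G ∧
    ∀ x : ℝ, (Polynomial.derivative F * G - F * Polynomial.derivative G).eval x ≤ 0

/-- `F ≺ G` : `F ≼ G` and no common zeros. -/
def PrecS (F G : Polynomial ℝ) : Prop :=
  Prec F G ∧ ∀ x : ℝ, ¬ (F.eval x = 0 ∧ G.eval x = 0)

/-- `F ≺₀ G` : `F ≼ G` and no common zeros except possibly at the origin. -/
def Prec0 (F G : Polynomial ℝ) : Prop :=
  Prec F G ∧ ∀ x : ℝ, x ≠ 0 → ¬ (F.eval x = 0 ∧ G.eval x = 0)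

/-- `F ⋎ G` : `G ≼ zF`. -/
def Veebar (F G : Polynomial ℝ) : Prop := Prec G (Polynomial.X * F)

/-- `F ∨ G` : `F ⋎ G` and no common zeros except possibly at the origin. -/
def VeeS (F G : Polynomial ℝ) : Prop :=
  Veebar F G ∧ ∀ x : ℝ, x ≠ 0 → ¬ (F.eval x = 0 ∧ G.eval x = 0)

/-- `F ⊴ G` : `F ⋎ G` for polynomials with only nonpositive zeros. -/
def TriLE (F G : Polynomial ℝ) : Prop :=
  OnlyNonposRoots F ∧ OnlyNonposRoots G ∧ Veebar F G

/-- `F ◁ G` : `F ∨ G` for polynomials with only nonpositive zeros. -/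
def TriLT (F G : Polynomial ℝ) : Prop :=
  OnlyNonposRoots F ∧ OnlyNonposRoots G ∧ VeeS F G

/-- `F` is extremal (in `𝓡̄_n(q)` or `𝓝̄_n(q)`): `F(z) = c · R_n(q; a z)` for
nonzero reals `a`, `c`. -/
def Extremal (n : ℕ) (q : ℝ) (F : Polynomial ℝ) : Prop :=
  ∃ a c : ℝ, a ≠ 0 ∧ c ≠ 0 ∧
    F = Polynomial.C c * (Rpoly n q).comp (Polynomial.C a * Polynomial.X)

/-- The q-difference operator `Δ_{q,n}`. -/
def qDelta (q : ℝ) (n : ℕ) (F : Polynomial ℝ) : Polynomial ℝ :=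
  if q = 1 then Polynomial.C ((n : ℝ)⁻¹) * Polynomial.derivative F
  else Polynomial.C (q ^ (n - 1) - q⁻¹)⁻¹ *
    (F - F.comp (Polynomial.C q⁻¹ * Polynomial.X)).divX

/-- The operator `Δ*_{q,n}`. -/
def qDeltaStar (q : ℝ) (n : ℕ) (F : Polynomial ℝ) : Polynomial ℝ :=
  if q = 1 then F - Polynomial.C ((n : ℝ)⁻¹) * (Polynomial.X * Polynomial.derivative F)
  else Polynomial.C (q⁻¹ ^ n - 1)⁻¹ *
    (Polynomial.C (q⁻¹ ^ n) * F - F.comp (Polynomial.C q⁻¹ * Polynomial.X))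

/-- The sequence `a_0, …, a_n` is strictly log-concave (`𝓛𝓒_n`):
`a_k² > a_{k-1} a_{k+1}` for every `k` for which there are `l ≤ k` and `m ≥ k`
with `a_l ≠ 0 ≠ a_m` (with the convention `a_{-1} = 0`). -/
def LCcond (n : ℕ) (a : ℕ → ℝ) : Prop :=
  ∀ k ≤ n, (∃ l, l ≤ k ∧ a l ≠ 0) → (∃ m, k ≤ m ∧ m ≤ n ∧ a m ≠ 0) →
    (if k = 0 then (0 : ℝ) else a (k - 1)) * a (k + 1) < a k ^ 2

/-- `σ_n(ℝ)`: the zero polynomial together with the polynomials of degree `n` or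
`n-1` with only real, simple zeros. -/
def sigmaR (n : ℕ) (P : Polynomial ℝ) : Prop :=
  P = 0 ∨ ((P.natDegree = n ∨ P.natDegree + 1 = n) ∧
    P.roots.card = P.natDegree ∧ ∀ x ∈ P.roots, P.roots.count x = 1)

/-- `P` and `Q` have strictly interspersed zeros: `P'Q - PQ'` never vanishes. -/
def StrictInt (P Q : Polynomial ℝ) : Prop :=
  ∀ t : ℝ, (Polynomial.derivative P * Q - P * Polynomial.derivative Q).eval t ≠ 0

end


lemma exists_eval_eq_zero_of_mul_nonpos (H : ℝ[X]) {a b : ℝ} (hab : a ≤ b)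
    (h : H.eval a * H.eval b ≤ 0) : ∃ z, a ≤ z ∧ z ≤ b ∧ H.eval z = 0 := by
  have hc : ContinuousOn (fun x => H.eval x) (Set.Icc a b) := H.continuous.continuousOn
  rcases mul_nonpos_iff.1 h with h | h
  · obtain ⟨z, hz, hz0⟩ := intermediate_value_Icc' hab hc ⟨h.2, h.1⟩
    exact ⟨z, hz.1, hz.2, hz0⟩
  · obtain ⟨z, hz, hz0⟩ := intermediate_value_Icc hab hc ⟨h.1, h.2⟩
    exact ⟨z, hz.1, hz.2, hz0⟩

lemma exists_gt_eval_pos (H : ℝ[X]) (a : ℝ) (h : 0 < H.leadingCoeff) :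
    ∃ b, a < b ∧ 0 < H.eval b := by
  rcases Nat.eq_zero_or_pos H.natDegree with hd | hd
  · refine ⟨a + 1, by linarith, ?_⟩
    rw [eq_C_of_natDegree_eq_zero hd, eval_C]
    rwa [leadingCoeff, hd] at h
  · have := H.tendsto_atTop_of_leadingCoeff_nonneg (natDegree_pos_iff_degree_pos.1 hd) h.le
    exact ((eventually_gt_atTop a).and (this.eventually_gt_atTop 0)).exists

lemma exists_gt_eval_eq_zero (H : ℝ[X]) (a : ℝ) (h : H.eval a * H.leadingCoeff < 0) :
    ∃ z, a < z ∧ H.eval z = 0 := by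
  have key : ∃ b, a < b ∧ H.eval a * H.eval b ≤ 0 := by
    rcases mul_neg_iff.1 h with h | h
    · obtain ⟨b, hb, hb'⟩ := exists_gt_eval_pos (-H) a (by simpa using h.2)
      rw [eval_neg] at hb'
      exact ⟨b, hb, by nlinarith⟩
    · obtain ⟨b, hb, hb'⟩ := exists_gt_eval_pos H a h.2
      exact ⟨b, hb, by nlinarith⟩
  obtain ⟨b, hb, hb'⟩ := key
  obtain ⟨z, hz, -, hz0⟩ := exists_eval_eq_zero_of_mul_nonpos H hb.le hb'
  refine ⟨z, lt_of_le_of_ne hz ?_, hz0⟩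
  rintro rfl
  simp [hz0] at h

section PositiveZeros

variable {q c k : ℝ} {F G : ℝ[X]}

/-- Between consecutive positive zeros `y ≤ q * y'` of `F` lies a zero of `G` in `[y, q * y']`. -/
lemma exists_zero_between (hq0 : 0 < q) (hq1 : q < 1) (hc : 0 < c)
    (hG : ∀ x, G.eval x = k * (c * F.eval x - F.eval (x / q))) {y y' : ℝ} (hy : 0 < y)
    (hFy : F.eval y = 0) (hFy' : F.eval y' = 0) (hle : y ≤ q * y')
    (hno : ∀ x, y < x → x < y' → F.eval x ≠ 0) :
    ∃ z, y ≤ z ∧ z ≤ q * y' ∧ (y < q * y' → k ≠ 0 → z < q * y') ∧ G.eval z = 0 := by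
  have hy' : 0 < y' := by
    by_contra! h
    nlinarith
  have hqy' : q * y' < y' := by nlinarith
  have hyq : y < y / q := by rw [lt_div_iff₀ hq0]; nlinarith
  have hyq' : y / q ≤ y' := by rw [div_le_iff₀ hq0]; linarith
  have h1 : G.eval y = -(k * F.eval (y / q)) := by rw [hG, hFy]; ring
  have h2 : G.eval (q * y') = k * c * F.eval (q * y') := by
    rw [hG, mul_div_cancel_left₀ _ hq0.ne', hFy']; ring
  have hsign : 0 ≤ F.eval (y / q) * F.eval (q * y') := by
    by_contra! hneg
    have hne1 : F.eval (y / q) ≠ 0 := left_ne_zero_of_mul hneg.ne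
    have hne2 : F.eval (q * y') ≠ 0 := right_ne_zero_of_mul hneg.ne
    rcases le_total (y / q) (q * y') with h | h
    · obtain ⟨z, hz1, hz2, hz⟩ := exists_eval_eq_zero_of_mul_nonpos F h hneg.le
      exact hno z (by linarith) (by linarith) hz
    · obtain ⟨z, hz1, hz2, hz⟩ := exists_eval_eq_zero_of_mul_nonpos F h
        (by rw [mul_comm]; exact hneg.le)
      refine hno z (lt_of_le_of_ne (hle.trans hz1) ?_) (lt_of_le_of_ne (hz2.trans hyq') ?_) hz
      · rintro rfl
        exact hne2 (by rw [le_antisymm hz1 hle, hFy])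
      · rintro rfl
        exact hne1 (by rw [le_antisymm hyq' hz2, hFy'])
  obtain ⟨z, hz1, hz2, hz⟩ := exists_eval_eq_zero_of_mul_nonpos G hle (by
    rw [h1, h2]
    have : 0 ≤ k ^ 2 * c * (F.eval (y / q) * F.eval (q * y')) := by positivity
    nlinarith)
  refine ⟨z, hz1, hz2, fun hlt hk => lt_of_le_of_ne hz2 ?_, hz⟩
  rintro rfl
  rw [h2] at hz
  exact hno _ hlt hqy' (by simpa [hk, hc.ne'] using hz)

/-- If the leading coefficients of `F` and `G` have the same sign, then `G` has a zero beyond the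
largest zero of `F`. -/
lemma exists_zero_beyond (hq0 : 0 < q) (hq1 : q < 1) (hk : 0 < k)
    (hG : ∀ x, G.eval x = k * (c * F.eval x - F.eval (x / q))) {y : ℝ} (hy : 0 < y)
    (hFy : F.eval y = 0) (hno : ∀ x, y < x → F.eval x ≠ 0)
    (hl : 0 < F.leadingCoeff * G.leadingCoeff) : ∃ z, y < z ∧ G.eval z = 0 := by
  have hyq : y < y / q := by rw [lt_div_iff₀ hq0]; nlinarith
  have h1 : G.eval y = -(k * F.eval (y / q)) := by rw [hG, hFy]; ring
  have hpos : 0 < F.eval (y / q) * F.leadingCoeff := by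
    have hl0 : F.leadingCoeff ≠ 0 := left_ne_zero_of_mul hl.ne'
    refine lt_of_le_of_ne ?_ (mul_ne_zero (hno _ hyq) hl0).symm
    by_contra! hneg
    obtain ⟨z, hz, hz0⟩ := exists_gt_eval_eq_zero F _ hneg
    exact hno z (hyq.trans hz) hz0
  refine exists_gt_eval_eq_zero G y ?_
  rw [h1]
  have h2 : 0 < F.eval (y / q) * G.leadingCoeff := by
    have := mul_pos hpos hl
    have h3 : 0 < F.leadingCoeff ^ 2 * (F.eval (y / q) * G.leadingCoeff) := by nlinarith
    exact pos_of_mul_pos_right h3 (sq_nonneg _)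
  nlinarith [mul_pos hk h2]

lemma exists_separated_positive_zeros (hq0 : 0 < q) (hq1 : q < 1) (hc : 0 < c) (hk : 0 < k)
    (hG : ∀ x, G.eval x = k * (c * F.eval x - F.eval (x / q))) (P : Finset ℝ)
    (hP : ∀ x, x ∈ P ↔ 0 < x ∧ F.eval x = 0) (hsep : ∀ x ∈ P, ∀ y ∈ P, x < y → x ≤ q * y) :
    ∃ Z : Finset ℝ, (∀ z ∈ Z, 0 < z ∧ G.eval z = 0) ∧
      (∀ x ∈ Z, ∀ y ∈ Z, x < y → x ≤ q * y) ∧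
      ((∀ x ∈ P, ∀ y ∈ P, x < y → x < q * y) → ∀ x ∈ Z, ∀ y ∈ Z, x < y → x < q * y) ∧
      P.card ≤ Z.card + 1 ∧ (0 < F.leadingCoeff * G.leadingCoeff → P.card ≤ Z.card) := by
  have step : ∀ y ∈ P, ((∃ y' ∈ P, y < y') ∨ 0 < F.leadingCoeff * G.leadingCoeff) →
      ∃ z, y ≤ z ∧ G.eval z = 0 ∧ ∀ y' ∈ P, y < y' → z ≤ q * y' ∧ (y < q * y' → z < q * y') := by
    intro y hy h
    by_cases hex : ∃ y' ∈ P, y < y'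
    · obtain ⟨w, hw, hyw⟩ := hex
      obtain ⟨y', hy', hmin⟩ := (P.filter (y < ·)).exists_min_image id
        ⟨w, Finset.mem_filter.2 ⟨hw, hyw⟩⟩
      rw [Finset.mem_filter] at hy'
      have hy0 := (hP y).1 hy
      obtain ⟨z, hz1, hz2, hz3, hz⟩ := exists_zero_between hq0 hq1 hc hG hy0.1 hy0.2
        ((hP y').1 hy'.1).2 (hsep y hy y' hy'.1 hy'.2) (fun x hx1 hx2 hx => by
          have := hmin x (Finset.mem_filter.2 ⟨(hP x).2 ⟨hy0.1.trans hx1, hx⟩, hx1⟩)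
          exact absurd hx2 (not_lt.2 this))
      refine ⟨z, hz1, hz, fun v hv hyv => ?_⟩
      have hle : y' ≤ v := hmin v (Finset.mem_filter.2 ⟨hv, hyv⟩)
      have hle' : q * y' ≤ q * v := mul_le_mul_of_nonneg_left hle hq0.le
      refine ⟨hz2.trans hle', fun hlt => ?_⟩
      rcases hle.eq_or_lt with rfl | hlt'
      · exact hz3 hlt hk.ne'
      · exact hz2.trans_lt (mul_lt_mul_of_pos_left hlt' hq0)
    · have hl := h.resolve_left hex
      push Not at hex
      have hy0 := (hP y).1 hy
      obtain ⟨z, hz1, hz⟩ := exists_zero_beyond hq0 hq1 hk hG hy0.1 hy0.2 (fun x hx hx0 =>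
        absurd hx (not_lt.2 (hex x ((hP x).2 ⟨hy0.1.trans hx, hx0⟩)))) hl
      exact ⟨z, hz1.le, hz, fun v hv hyv => absurd hyv (not_lt.2 (hex v hv))⟩
  choose! f hf1 hf2 hf3 using step
  have main : ∀ P' ⊆ P, (∀ y ∈ P', (∃ y' ∈ P, y < y') ∨ 0 < F.leadingCoeff * G.leadingCoeff) →
      ∃ Z : Finset ℝ, (∀ z ∈ Z, 0 < z ∧ G.eval z = 0) ∧
      (∀ x ∈ Z, ∀ y ∈ Z, x < y → x ≤ q * y) ∧
      ((∀ x ∈ P, ∀ y ∈ P, x < y → x < q * y) → ∀ x ∈ Z, ∀ y ∈ Z, x < y → x < q * y) ∧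
      Z.card = P'.card := by
    intro P' hP' hgood
    have hpos : ∀ y ∈ P', 0 < f y := fun y hy =>
      ((hP y).1 (hP' hy)).1.trans_le (hf1 y (hP' hy) (hgood y hy))
    have hlt : ∀ x ∈ P', ∀ y ∈ P', x < y → f x ≤ q * f y ∧ (x < q * y → f x < q * f y) := by
      intro x hx y hy hxy
      have h1 := hf3 x (hP' hx) (hgood x hx) y (hP' hy) hxy
      have h2 : q * y ≤ q * f y := mul_le_mul_of_nonneg_left (hf1 y (hP' hy) (hgood y hy)) hq0.le
      exact ⟨h1.1.trans h2, fun h => (h1.2 h).trans_le h2⟩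
    have hmono : ∀ x ∈ P', ∀ y ∈ P', x < y → f x < f y := fun x hx y hy hxy => by
      have := (hlt x hx y hy hxy).1
      nlinarith [hpos y hy]
    have hrefl : ∀ x ∈ P', ∀ y ∈ P', f x < f y → x < y := fun x hx y hy hxy => by
      by_contra! hle
      rcases hle.eq_or_lt with rfl | h
      · exact lt_irrefl _ hxy
      · exact lt_asymm hxy (hmono y hy x hx h)
    refine ⟨P'.image f, ?_, ?_, ?_, Finset.card_image_of_injOn ?_⟩
    · simp only [Finset.forall_mem_image]
      exact fun y hy => ⟨hpos y hy, hf2 y (hP' hy) (hgood y hy)⟩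
    · simp only [Finset.forall_mem_image]
      exact fun x hx y hy h => (hlt x hx y hy (hrefl x hx y hy h)).1
    · simp only [Finset.forall_mem_image]
      exact fun hs x hx y hy h => (hlt x hx y hy (hrefl x hx y hy h)).2
        (hs x (hP' hx) y (hP' hy) (hrefl x hx y hy h))
    · intro x hx y hy hxy
      by_contra hne
      rcases lt_or_gt_of_ne hne with h | h
      · exact (hmono x hx y hy h).ne hxy
      · exact (hmono y hy x hx h).ne hxy.symm
  by_cases hl : 0 < F.leadingCoeff * G.leadingCoeff
  · obtain ⟨Z, h1, h2, h3, h4⟩ := main P subset_rfl fun _ _ => Or.inr hl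
    exact ⟨Z, h1, h2, h3, by omega, fun _ => by omega⟩
  · rcases P.eq_empty_or_nonempty with rfl | hne
    · exact ⟨∅, by simp, by simp, by simp, by simp, by simp⟩
    · obtain ⟨Z, h1, h2, h3, h4⟩ := main (P.erase (P.max' hne)) (P.erase_subset _) fun y hy =>
        Or.inl ⟨_, P.max'_mem hne, P.lt_max'_of_mem_erase_max' hne hy⟩
      rw [Finset.card_erase_of_mem (P.max'_mem hne)] at h4
      exact ⟨Z, h1, h2, h3, by omega, fun h => absurd h hl⟩

end PositiveZeros

noncomputable section

/-- The factor by which `qDeltaStar q n` multiplies the coefficient of index `j`. -/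
def qDeltaStarWeight (q : ℝ) (n j : ℕ) : ℝ :=
  if q = 1 then 1 - (n : ℝ)⁻¹ * j else (q⁻¹ ^ n - 1)⁻¹ * (q⁻¹ ^ n - q⁻¹ ^ j)

lemma coeff_qDeltaStar (q : ℝ) (n : ℕ) (F : ℝ[X]) (j : ℕ) :
    (qDeltaStar q n F).coeff j = qDeltaStarWeight q n j * F.coeff j := by
  unfold qDeltaStar qDeltaStarWeight
  split_ifs
  · rw [coeff_sub, coeff_C_mul]
    cases j with
    | zero => simp
    | succ j => rw [coeff_X_mul, coeff_derivative]; push_cast; ring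
  · rw [coeff_C_mul, coeff_sub, coeff_C_mul, comp_C_mul_X_coeff]
    ring

lemma qDeltaStarWeight_self {q : ℝ} {n : ℕ} (hn : 1 ≤ n) : qDeltaStarWeight q n n = 0 := by
  have : (n : ℝ) ≠ 0 := by positivity
  unfold qDeltaStarWeight
  split_ifs <;> simp [this]

lemma qDeltaStarWeight_pos {q : ℝ} {n j : ℕ} (hq0 : 0 < q) (hq1 : q ≤ 1) (hj : j < n) :
    0 < qDeltaStarWeight q n j := by
  unfold qDeltaStarWeight
  split_ifs with h
  · have hn : (0 : ℝ) < n := by exact_mod_cast (Nat.zero_le j).trans_lt hj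
    have hjn : (j : ℝ) < n := by exact_mod_cast hj
    rw [sub_pos, inv_mul_lt_iff₀ hn]
    linarith
  · have h1 : 1 < q⁻¹ := (one_lt_inv₀ hq0).2 (lt_of_le_of_ne hq1 h)
    have h2 : 1 < q⁻¹ ^ n := one_lt_pow₀ h1 (by omega)
    have h3 : q⁻¹ ^ j < q⁻¹ ^ n := pow_lt_pow_right₀ h1 hj
    exact mul_pos (inv_pos.2 (by linarith)) (by linarith)

lemma qDeltaStarWeight_nonneg {q : ℝ} {n j : ℕ} (hq0 : 0 < q) (hq1 : q ≤ 1) (hn : 1 ≤ n)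
    (hj : j ≤ n) : 0 ≤ qDeltaStarWeight q n j := by
  rcases hj.eq_or_lt with rfl | h
  · rw [qDeltaStarWeight_self hn]
  · exact (qDeltaStarWeight_pos hq0 hq1 h).le

lemma eval_qDeltaStar {q : ℝ} (hq : q ≠ 1) (n : ℕ) (F : ℝ[X]) (x : ℝ) :
    (qDeltaStar q n F).eval x = (q⁻¹ ^ n - 1)⁻¹ * (q⁻¹ ^ n * F.eval x - F.eval (x / q)) := by
  rw [qDeltaStar, if_neg hq]
  simp [div_eq_inv_mul]

lemma natDegree_qDeltaStar_le (q : ℝ) (n : ℕ) (F : ℝ[X]) :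
    (qDeltaStar q n F).natDegree ≤ F.natDegree := by
  refine natDegree_le_iff_coeff_eq_zero.2 fun j hj => ?_
  rw [coeff_qDeltaStar, coeff_eq_zero_of_natDegree_lt hj, mul_zero]

lemma natDegree_qDeltaStar_lt {q : ℝ} {F : ℝ[X]} (hn : 1 ≤ F.natDegree) :
    (qDeltaStar q F.natDegree F).natDegree < F.natDegree := by
  refine Nat.lt_of_le_pred hn (natDegree_le_iff_coeff_eq_zero.2 fun j hj => ?_)
  rw [coeff_qDeltaStar]
  rcases (show F.natDegree ≤ j from Nat.le_of_pred_lt hj).eq_or_lt with h | h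
  · rw [← h, qDeltaStarWeight_self hn, zero_mul]
  · rw [coeff_eq_zero_of_natDegree_lt h, mul_zero]

lemma natDegree_qDeltaStar {q : ℝ} {n : ℕ} {F : ℝ[X]} (hq0 : 0 < q) (hq1 : q ≤ 1)
    (hF : F.natDegree < n) : (qDeltaStar q n F).natDegree = F.natDegree := by
  by_cases h0 : F = 0
  · have := natDegree_qDeltaStar_le q n F
    simp_all
  refine le_antisymm (natDegree_qDeltaStar_le q n F) (le_natDegree_of_ne_zero ?_)
  rw [coeff_qDeltaStar]
  exact mul_ne_zero (qDeltaStarWeight_pos hq0 hq1 hF).ne' (leadingCoeff_ne_zero.2 h0)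

lemma count_zero_roots_le_qDeltaStar {q : ℝ} {n : ℕ} {F : ℝ[X]} (hG : qDeltaStar q n F ≠ 0) :
    F.roots.count 0 ≤ (qDeltaStar q n F).roots.count 0 := by
  rw [count_roots, count_roots, le_rootMultiplicity_iff hG]
  have h := F.pow_rootMultiplicity_dvd 0
  rw [C_0, sub_zero, X_pow_dvd_iff] at h ⊢
  intro d hd
  rw [coeff_qDeltaStar, h d hd, mul_zero]

/-- The positive zeros of `F`, without multiplicity. -/
def posZeros (F : ℝ[X]) : Finset ℝ := F.roots.toFinset.filter (0 < ·)

lemma mem_posZeros {F : ℝ[X]} (hF : F ≠ 0) {x : ℝ} :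
    x ∈ posZeros F ↔ 0 < x ∧ F.eval x = 0 := by
  simp [posZeros, hF, and_comm]

lemma comp_neg_X_ne_zero {F : ℝ[X]} (hF : F ≠ 0) : F.comp (-X) ≠ 0 := fun h => hF <| by
  rw [← comp_neg_X_comp_neg_X F, h, zero_comp]

lemma mem_posZeros_comp_neg_X {F : ℝ[X]} (hF : F ≠ 0) {x : ℝ} :
    x ∈ posZeros (F.comp (-X)) ↔ 0 < x ∧ F.eval (-x) = 0 := by
  simp [mem_posZeros (comp_neg_X_ne_zero hF)]

lemma card_roots_le_of_simple {F : ℝ[X]} (hF : F ≠ 0)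
    (hs : ∀ x ∈ F.roots, x ≠ 0 → F.roots.count x < 2) :
    F.roots.card ≤ F.roots.count 0 + (posZeros F).card + (posZeros (F.comp (-X))).card := by
  have hle : F.roots ≤ Multiset.replicate (F.roots.count 0) 0 + (posZeros F).val +
      ((posZeros (F.comp (-X))).image (- ·)).val := by
    rw [Multiset.le_iff_count]
    intro x
    rw [Multiset.count_add, Multiset.count_add, Multiset.count_replicate]
    by_cases hx : x ∈ F.roots
    · have hx0 : F.eval x = 0 := (mem_roots hF).1 hx
      rcases lt_trichotomy x 0 with h | rfl | h
      · have : x ∈ (posZeros (F.comp (-X))).image (- ·) :=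
          Finset.mem_image.2 ⟨-x, (mem_posZeros_comp_neg_X hF).2 (by simpa [h] using hx0),
            neg_neg x⟩
        have := Multiset.one_le_count_iff_mem.2 this
        have := hs x hx h.ne
        omega
      · rw [if_pos rfl]
        omega
      · have : x ∈ posZeros F := (mem_posZeros hF).2 ⟨h, hx0⟩
        have := Multiset.one_le_count_iff_mem.2 this
        have := hs x hx h.ne'
        omega
    · simp [Multiset.count_eq_zero_of_notMem hx]
  refine (Multiset.card_le_card hle).trans_eq ?_
  rw [Multiset.card_add, Multiset.card_add, Multiset.card_replicate, Finset.card_val,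
    Finset.card_val, Finset.card_image_of_injective _ neg_injective]

lemma roots_eq_of_natDegree_le {G : ℝ[X]} (hG : G ≠ 0) {m : ℕ} {Z W : Finset ℝ}
    (hm : m ≤ G.roots.count 0) (hZ : ∀ z ∈ Z, 0 < z ∧ G.eval z = 0)
    (hW : ∀ z ∈ W, 0 < z ∧ G.eval (-z) = 0) (hd : G.natDegree ≤ m + Z.card + W.card) :
    G.roots.card = G.natDegree ∧ G.roots = Multiset.replicate m 0 + Z.val + (W.image (- ·)).val := by
  have hle : Multiset.replicate m 0 + Z.val + (W.image (- ·)).val ≤ G.roots := by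
    rw [Multiset.le_iff_count]
    intro x
    rw [Multiset.count_add, Multiset.count_add, Multiset.count_replicate]
    have hZx : x ∈ Z → 1 ≤ G.roots.count x := fun h =>
      Multiset.one_le_count_iff_mem.2 ((mem_roots hG).2 (hZ x h).2)
    have hWx : x ∈ W.image (- ·) → x < 0 ∧ 1 ≤ G.roots.count x := fun h => by
      obtain ⟨w, hw, rfl⟩ := Finset.mem_image.1 h
      exact ⟨neg_neg_of_pos (hW w hw).1,
        Multiset.one_le_count_iff_mem.2 ((mem_roots hG).2 (hW w hw).2)⟩
    have e1 := Multiset.count_eq_of_nodup (a := x) Z.nodup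
    have e2 := Multiset.count_eq_of_nodup (a := x) (W.image (- ·)).nodup
    simp only [Finset.mem_val] at e1 e2
    rw [e1, e2]
    rcases lt_trichotomy x 0 with h | rfl | h
    · have h1 : x ∉ Z := fun h' => lt_asymm h (hZ x h').1
      simp only [h1, h.ne', if_false]
      split_ifs with h2
      · simpa using (hWx h2).2
      · simp
    · have h1 : (0 : ℝ) ∉ Z := fun h' => lt_irrefl _ (hZ 0 h').1
      have h2 : (0 : ℝ) ∉ W.image (- ·) := fun h' => lt_irrefl _ (hWx h').1
      simp only [h1, h2, if_true, if_false]
      exact hm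
    · have h2 : x ∉ W.image (- ·) := fun h' => lt_asymm h (hWx h').1
      simp only [h2, h.ne, if_false]
      split_ifs with h1
      · simpa using hZx h1
      · simp
  have hcard : (Multiset.replicate m 0 + Z.val + (W.image (- ·)).val).card =
      m + Z.card + W.card := by
    rw [Multiset.card_add, Multiset.card_add, Multiset.card_replicate, Finset.card_val,
      Finset.card_val, Finset.card_image_of_injective _ neg_injective]
  have h1 := Multiset.card_le_card hle
  have h2 := G.card_roots'
  exact ⟨by omega, (Multiset.eq_of_le_of_card_le hle (by omega)).symm⟩

lemma count_replicate_add_add_lt_two {m : ℕ} {Z W : Finset ℝ} (hZ : ∀ z ∈ Z, 0 < z)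
    (hW : ∀ z ∈ W, 0 < z) {x : ℝ} (hx : x ≠ 0) :
    (Multiset.replicate m 0 + Z.val + (W.image (- ·)).val).count x < 2 := by
  rw [Multiset.count_add, Multiset.count_add, Multiset.count_replicate, if_neg hx.symm]
  have h1 := Multiset.nodup_iff_count_le_one.1 Z.nodup x
  have h2 := Multiset.nodup_iff_count_le_one.1 (W.image (- ·)).nodup x
  by_cases h : x ∈ Z.val
  · have : x ∉ (W.image (- ·)).val := fun h' => by
      obtain ⟨w, hw, rfl⟩ := Finset.mem_image.1 h'
      have := hZ _ h
      have := hW _ hw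
      linarith
    rw [Multiset.count_eq_zero_of_notMem this]
    omega
  · rw [Multiset.count_eq_zero_of_notMem h]
    omega

lemma separated_replicate_add_add {r : ℝ → ℝ → Prop} {m : ℕ} {Z W : Finset ℝ}
    (hZ : ∀ z ∈ Z, 0 < z) (hW : ∀ z ∈ W, 0 < z) (hrZ : ∀ x ∈ Z, ∀ y ∈ Z, x < y → r x y)
    (hrW : ∀ x ∈ W, ∀ y ∈ W, x < y → r (-x) (-y)) :
    ∀ x ∈ Multiset.replicate m 0 + Z.val + (W.image (- ·)).val,
      ∀ y ∈ Multiset.replicate m 0 + Z.val + (W.image (- ·)).val,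
      ((y < x ∧ x < 0) ∨ (0 < x ∧ x < y)) → r x y := by
  have hpos : ∀ x ∈ Multiset.replicate m 0 + Z.val + (W.image (- ·)).val, 0 < x → x ∈ Z := by
    intro x hx hx0
    rw [Multiset.mem_add, Multiset.mem_add] at hx
    rcases hx with (hx | hx) | hx
    · exact absurd (Multiset.eq_of_mem_replicate hx) hx0.ne'
    · exact hx
    · obtain ⟨w, hw, rfl⟩ := Finset.mem_image.1 hx
      have := hW _ hw
      linarith
  have hneg : ∀ x ∈ Multiset.replicate m 0 + Z.val + (W.image (- ·)).val, x < 0 →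
      ∃ w ∈ W, -w = x := by
    intro x hx hx0
    rw [Multiset.mem_add, Multiset.mem_add] at hx
    rcases hx with (hx | hx) | hx
    · exact absurd (Multiset.eq_of_mem_replicate hx) hx0.ne
    · exact absurd (hZ x hx) (not_lt.2 hx0.le)
    · exact Finset.mem_image.1 hx
  rintro x hx y hy (⟨h1, h2⟩ | ⟨h1, h2⟩)
  · obtain ⟨w, hw, rfl⟩ := hneg x hx h2
    obtain ⟨v, hv, rfl⟩ := hneg y hy (h1.trans h2)
    exact hrW w hw v hv (by linarith)
  · exact hrZ x (hpos x hx h1) y (hpos y hy (h1.trans h2)) h2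

lemma qDeltaStar_of_lt_one {n : ℕ} (hn : 1 ≤ n) {q : ℝ} (hq0 : 0 < q) (hq1 : q < 1) {F : ℝ[X]}
    (hdeg : F.natDegree ≤ n) (hroots : F.roots.card = F.natDegree) (hsep : LogSep q F.roots)
    (hG0 : qDeltaStar q n F ≠ 0) :
    (qDeltaStar q n F).roots.card = (qDeltaStar q n F).natDegree ∧
      LogSep q (qDeltaStar q n F).roots ∧
      (StrictLogSep q F.roots → StrictLogSep q (qDeltaStar q n F).roots) := by
  set G := qDeltaStar q n F with hGdef
  have hF : F ≠ 0 := by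
    rintro rfl
    exact hG0 (by ext j; rw [hGdef, coeff_qDeltaStar]; simp)
  have hp : 1 < q⁻¹ ^ n := one_lt_pow₀ ((one_lt_inv₀ hq0).2 hq1) (by omega)
  have hk : 0 < (q⁻¹ ^ n - 1)⁻¹ := inv_pos.2 (by linarith)
  have hc : 0 < q⁻¹ ^ n := by linarith
  have hGe := eval_qDeltaStar hq1.ne n F
  have hsimple : ∀ x ∈ F.roots, x ≠ 0 → F.roots.count x < 2 := fun x hx hx0 => by
    by_contra! h
    exact absurd (hsep.1 x hx hx0 h) (not_le.2 hq1)
  have hcardF := card_roots_le_of_simple hF hsimple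
  obtain ⟨Z, hZ, hZs, hZs', hZc, hZc'⟩ := exists_separated_positive_zeros hq0 hq1 hc hk hGe
    (posZeros F) (fun x => mem_posZeros hF) (fun x hx y hy hxy => by
      rw [mem_posZeros hF] at hx hy
      have := hsep.2 x ((mem_roots hF).2 hx.2) y ((mem_roots hF).2 hy.2) (Or.inr ⟨hx.1, hxy⟩)
      rwa [div_le_iff₀ hy.1] at this)
  obtain ⟨W, hW, hWs, hWs', hWc, hWc'⟩ := exists_separated_positive_zeros
    (F := F.comp (-X)) (G := G.comp (-X)) hq0 hq1 hc hk
    (fun x => by simp [hGdef, hGe, neg_div])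
    (posZeros (F.comp (-X))) (fun x => mem_posZeros (comp_neg_X_ne_zero hF))
    (fun x hx y hy hxy => by
      rw [mem_posZeros_comp_neg_X hF] at hx hy
      have := hsep.2 (-x) ((mem_roots hF).2 hx.2) (-y) ((mem_roots hF).2 hy.2)
        (Or.inl ⟨neg_lt_neg hxy, neg_neg_of_pos hx.1⟩)
      rwa [neg_div_neg_eq, div_le_iff₀ hy.1] at this)
  have hW' : ∀ z ∈ W, 0 < z ∧ G.eval (-z) = 0 := fun z hz => by simpa using hW z hz
  have hm : F.roots.count 0 ≤ G.roots.count 0 := count_zero_roots_le_qDeltaStar hG0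
  have hlead : ∀ H : ℝ[X], (H.comp (-X)).leadingCoeff = (-1) ^ H.natDegree * H.leadingCoeff := by
    intro H
    rw [leadingCoeff_comp (by simp)]
    simp [mul_comm]
  rw [hlead, hlead] at hWc'
  have hcount : G.natDegree ≤ F.roots.count 0 + Z.card + W.card := by
    rcases hdeg.eq_or_lt with hd | hd
    · have hlt : G.natDegree < F.natDegree := by
        rw [hGdef, ← hd]; exact natDegree_qDeltaStar_lt (hd ▸ hn)
      by_cases hpar : G.natDegree + 1 = F.natDegree
      · have hne : F.leadingCoeff * G.leadingCoeff ≠ 0 :=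
          mul_ne_zero (leadingCoeff_ne_zero.2 hF) (leadingCoeff_ne_zero.2 hG0)
        rcases lt_or_gt_of_ne hne with h | h
        · have := hWc' (by
            rw [← hpar, pow_succ]
            have h1 : ((-1 : ℝ) ^ G.natDegree) * (-1) ^ G.natDegree = 1 := by
              rw [← mul_pow]; simp
            linear_combination h +
              (F.leadingCoeff * G.leadingCoeff) * h1)
          omega
        · have := hZc' h
          omega
      · omega
    · have hGd : G.natDegree = F.natDegree := natDegree_qDeltaStar hq0 hq1.le hd
      have hl : 0 < F.leadingCoeff * G.leadingCoeff := by
        rw [leadingCoeff, leadingCoeff, hGd, hGdef, coeff_qDeltaStar]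
        have h1 := qDeltaStarWeight_pos hq0 hq1.le hd
        have h2 : F.coeff F.natDegree ≠ 0 := leadingCoeff_ne_zero.2 hF
        have := mul_pos h1 (pow_pos (abs_pos.2 h2) 2)
        rw [sq_abs] at this
        linarith
      have h1 := hZc' hl
      have h2 := hWc' (by
        rw [hGd]
        have h1 : ((-1 : ℝ) ^ F.natDegree) * (-1) ^ F.natDegree = 1 := by
          rw [← mul_pow]; simp
        linear_combination hl - (F.leadingCoeff * G.leadingCoeff) * h1)
      omega
  obtain ⟨h1, h2⟩ := roots_eq_of_natDegree_le hG0 hm hZ hW' hcount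
  have hZ0 : ∀ z ∈ Z, 0 < z := fun z hz => (hZ z hz).1
  have hW0 : ∀ z ∈ W, 0 < z := fun z hz => (hW z hz).1
  rw [h2] at h1 ⊢
  refine ⟨h1, ⟨fun x _ hx0 hx => absurd hx (not_le.2 ?_), ?_⟩, fun hstrict =>
    ⟨fun x _ hx0 hx => absurd hx (not_le.2 ?_), ?_⟩⟩
  · exact count_replicate_add_add_lt_two hZ0 hW0 hx0
  · refine separated_replicate_add_add hZ0 hW0 (fun x hx y hy hxy => ?_) fun x hx y hy hxy => ?_
    · rw [div_le_iff₀ (hZ0 y hy)]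
      exact hZs x hx y hy hxy
    · rw [neg_div_neg_eq, div_le_iff₀ (hW0 y hy)]
      exact hWs x hx y hy hxy
  · exact count_replicate_add_add_lt_two hZ0 hW0 hx0
  · refine separated_replicate_add_add hZ0 hW0 (fun x hx y hy hxy => ?_) fun x hx y hy hxy => ?_
    · rw [div_lt_iff₀ (hZ0 y hy)]
      refine hZs' (fun x hx y hy hxy => ?_) x hx y hy hxy
      rw [mem_posZeros hF] at hx hy
      have := hstrict.2 x ((mem_roots hF).2 hx.2) y ((mem_roots hF).2 hy.2) (Or.inr ⟨hx.1, hxy⟩)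
      rwa [div_lt_iff₀ hy.1] at this
    · rw [neg_div_neg_eq, div_lt_iff₀ (hW0 y hy)]
      refine hWs' (fun x hx y hy hxy => ?_) x hx y hy hxy
      rw [mem_posZeros_comp_neg_X hF] at hx hy
      have := hstrict.2 (-x) ((mem_roots hF).2 hx.2) (-y) ((mem_roots hF).2 hy.2)
        (Or.inl ⟨neg_lt_neg hxy, neg_neg_of_pos hx.1⟩)
      rwa [neg_div_neg_eq, div_lt_iff₀ hy.1] at this

lemma logSep_one (s : Multiset ℝ) : LogSep 1 s := by
  refine ⟨fun _ _ _ _ => le_rfl, ?_⟩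
  rintro x - y - (⟨h1, h2⟩ | ⟨h1, h2⟩)
  · exact div_le_one_of_ge h1.le (h1.trans h2).le
  · exact div_le_one_of_le₀ h2.le (h1.trans h2).le

lemma strictLogSep_one_iff (s : Multiset ℝ) :
    StrictLogSep 1 s ↔ ∀ x ∈ s, x ≠ 0 → s.count x < 2 := by
  constructor
  · intro h x hx hx0
    by_contra! h2
    exact lt_irrefl _ (h.1 x hx hx0 h2)
  · intro h
    refine ⟨fun x hx hx0 h2 => absurd h2 (not_le.2 (h x hx hx0)), ?_⟩
    rintro x - y - (⟨h1, h2⟩ | ⟨h1, h2⟩)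
    · rw [div_lt_one_of_neg (h1.trans h2)]
      exact h1
    · rw [div_lt_one (h1.trans h2)]
      exact h2

lemma Polynomial.Splits.reflect {F : ℝ[X]} (hF : F.Splits) {N : ℕ} (hN : F.natDegree ≤ N) :
    (F.reflect N).Splits := by
  have key : ∀ s : Multiset ℝ, ∀ M : ℕ, s.card ≤ M →
      (((s.map fun r => X - C r).prod).reflect M).Splits := by
    intro s
    induction s using Multiset.induction with
    | empty =>
      intro M _
      simp [reflect_one]
    | cons r s ih =>
      intro M hM
      rw [Multiset.card_cons] at hM
      obtain ⟨K, rfl⟩ : ∃ K, M = 1 + K := ⟨M - 1, by omega⟩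
      rw [Multiset.map_cons, Multiset.prod_cons, reflect_mul _ _ (natDegree_X_sub_C_le r)
        (by rw [natDegree_multiset_prod_X_sub_C_eq_card]; omega)]
      refine Splits.mul (Splits.of_natDegree_le_one ?_) (ih K (by omega))
      exact natDegree_reflect_le.trans (by simp)
  rw [hF.eq_prod_roots, reflect_C_mul]
  exact (Splits.C _).mul (key _ N (F.card_roots'.trans hN))

lemma splits_derivative {F : ℝ[X]} (hF : F.Splits) : (derivative F).Splits := by
  rw [splits_iff_card_roots]
  have h1 := card_roots_le_derivative F
  have h2 := (derivative F).card_roots'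
  have h3 := natDegree_derivative_le F
  rw [← hF.natDegree_eq_card_roots] at h1
  omega

lemma reflect_derivative_reflect {n : ℕ} (hn : 1 ≤ n) {F : ℝ[X]} (hdeg : F.natDegree ≤ n) :
    (derivative (F.reflect n)).reflect (n - 1) = C (n : ℝ) * qDeltaStar 1 n F := by
  have hn0 : (n : ℝ) ≠ 0 := by positivity
  ext j
  rw [coeff_reflect, coeff_derivative, coeff_reflect, coeff_C_mul, coeff_qDeltaStar,
    qDeltaStarWeight, if_pos rfl]
  rcases le_or_gt j (n - 1) with h | h
  · rw [revAt_le h, revAt_le (by omega), show n - (n - 1 - j + 1) = j by omega]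
    have : ((n - 1 - j : ℕ) : ℝ) + 1 = n - j := by
      rw [eq_sub_iff_add_eq]
      exact_mod_cast (by omega : n - 1 - j + 1 + j = n)
    rw [this]
    field_simp
  · rw [revAt_eq_self_of_lt h, revAt_eq_self_of_lt (by omega),
      coeff_eq_zero_of_natDegree_lt (by omega : F.natDegree < j + 1)]
    rcases (show n ≤ j by omega).eq_or_lt with rfl | h'
    · simp [hn0]
    · rw [coeff_eq_zero_of_natDegree_lt (by omega : F.natDegree < j)]
      simp

lemma splits_qDeltaStar_one {n : ℕ} (hn : 1 ≤ n) {F : ℝ[X]} (hF : F.Splits)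
    (hdeg : F.natDegree ≤ n) : (qDeltaStar 1 n F).Splits := by
  have hn0 : (n : ℝ) ≠ 0 := by positivity
  have h := (splits_derivative (hF.reflect hdeg)).reflect (N := n - 1)
    ((natDegree_derivative_le _).trans
      (Nat.sub_le_sub_right (natDegree_reflect_le.trans (by simp [hdeg])) 1))
  rw [reflect_derivative_reflect hn hdeg] at h
  by_cases h0 : qDeltaStar 1 n F = 0
  · rw [h0]
    exact Splits.zero
  · exact h.of_dvd (mul_ne_zero (C_ne_zero.2 hn0) h0) (dvd_mul_left _ _)

/-- A shifted form of the Laguerre identity `P'² - P P'' = P² ∑ (x - r)⁻²`. -/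
lemma laguerre_identity (s : Multiset ℝ) (x t : ℝ) (hx : x ∉ s) :
    let P := (s.map fun r => X - C r).prod
    (derivative P).eval x ^ 2 - P.eval x * (derivative (derivative P)).eval x
      - 2 * t * P.eval x * (derivative P).eval x + s.card * t ^ 2 * P.eval x ^ 2
      = P.eval x ^ 2 * (s.map fun r => ((x - r)⁻¹ - t) ^ 2).sum := by
  induction s using Multiset.induction with
  | empty => simp
  | cons r s ih =>
    rw [Multiset.mem_cons, not_or] at hx
    have hxr : x - r ≠ 0 := sub_ne_zero.2 hx.1
    have ih' := ih hx.2
    simp only [Multiset.map_cons, Multiset.prod_cons, Multiset.sum_cons, Multiset.card_cons,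
      derivative_mul, derivative_sub, derivative_X, derivative_C, sub_zero, one_mul,
      derivative_add, eval_add, eval_mul, eval_sub, eval_X, eval_C, Nat.cast_add,
      Nat.cast_one] at ih' ⊢
    have hu : (x - r)⁻¹ * (x - r) = 1 := inv_mul_cancel₀ hxr
    linear_combination (x - r) ^ 2 * ih' +
      eval x (s.map fun r => X - C r).prod ^ 2 * (2 * t * (x - r) - (x - r)⁻¹ * (x - r) - 1) * hu

lemma eval_eq_zero_of_double_zero_qDeltaStar_one {n : ℕ} (hn : 1 ≤ n) {F : ℝ[X]} (hF : F.Splits)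
    (hdeg : F.natDegree ≤ n) (hG0 : qDeltaStar 1 n F ≠ 0) {x : ℝ} (hx0 : x ≠ 0)
    (h1 : (qDeltaStar 1 n F).eval x = 0) (h2 : (derivative (qDeltaStar 1 n F)).eval x = 0) :
    F.eval x = 0 := by
  by_contra hFx
  have hn0 : (n : ℝ) ≠ 0 := by positivity
  have hF0 : F ≠ 0 := by
    rintro rfl
    simp at hFx
  rw [qDeltaStar, if_pos rfl] at h1 h2
  simp only [derivative_sub, derivative_mul, derivative_C, derivative_X, zero_mul, zero_add,
    one_mul, eval_sub, eval_mul, eval_add, eval_C, eval_X] at h1 h2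
  have e1 : (derivative F).eval x = n * F.eval x * x⁻¹ := by
    field_simp at h1 ⊢
    linarith
  have e2 : (derivative (derivative F)).eval x = n * (n - 1) * F.eval x * x⁻¹ ^ 2 := by
    have : (derivative (derivative F)).eval x = (n - 1) * (derivative F).eval x * x⁻¹ := by
      field_simp at h2 ⊢
      linarith
    rw [this, e1]
    ring
  have hxs : x ∉ F.roots := fun h => hFx ((mem_roots hF0).1 h)
  have hl0 : F.leadingCoeff ≠ 0 := leadingCoeff_ne_zero.2 hF0
  have hL := laguerre_identity F.roots x x⁻¹ hxs
  have hFP := hF.eq_prod_roots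
  set P := (F.roots.map fun r => X - C r).prod
  have d0 : F.eval x = F.leadingCoeff * P.eval x := by
    conv_lhs => rw [hFP]
    simp
  have d1 : (derivative F).eval x = F.leadingCoeff * (derivative P).eval x := by
    conv_lhs => rw [hFP]
    simp
  have d2 : (derivative (derivative F)).eval x =
      F.leadingCoeff * (derivative (derivative P)).eval x := by
    conv_lhs => rw [hFP]
    simp
  have hPx : P.eval x ≠ 0 := fun h => hFx (by rw [d0, h, mul_zero])
  rw [d0, d1] at e1
  rw [d0, d2] at e2
  have p1 : (derivative P).eval x = n * P.eval x * x⁻¹ := by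
    apply mul_left_cancel₀ hl0
    rw [e1]
    ring
  have p2 : (derivative (derivative P)).eval x = n * (n - 1) * P.eval x * x⁻¹ ^ 2 := by
    apply mul_left_cancel₀ hl0
    rw [e2]
    ring
  have hS : (F.roots.map fun r => ((x - r)⁻¹ - x⁻¹) ^ 2).sum = (F.roots.card - n) * x⁻¹ ^ 2 := by
    apply mul_left_cancel₀ (pow_ne_zero 2 hPx)
    simp only at hL
    rw [← hL, p1, p2]
    ring
  have hcard : F.roots.card ≤ n := F.card_roots'.trans hdeg
  have hnonneg : ∀ y ∈ F.roots.map fun r => ((x - r)⁻¹ - x⁻¹) ^ 2, 0 ≤ y := by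
    intro y hy
    obtain ⟨r, -, rfl⟩ := Multiset.mem_map.1 hy
    positivity
  have hxp : 0 < x⁻¹ ^ 2 := by positivity
  have hcard' : (F.roots.card : ℝ) ≤ n := by exact_mod_cast hcard
  have hsum := Multiset.sum_nonneg hnonneg
  have hcn : (F.roots.card : ℝ) = n := by
    refine le_antisymm hcard' ?_
    rw [hS] at hsum
    have := nonneg_of_mul_nonneg_left hsum hxp
    linarith
  have hall : ∀ r ∈ F.roots, r = 0 := by
    intro r hr
    have hle := Multiset.single_le_sum hnonneg _ (Multiset.mem_map_of_mem _ hr)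
    rw [hS, hcn, sub_self, zero_mul] at hle
    have h0 : (x - r)⁻¹ - x⁻¹ = 0 := by
      exact pow_eq_zero_iff two_ne_zero |>.1 (le_antisymm hle (sq_nonneg _))
    have := inv_injective (sub_eq_zero.1 h0)
    linarith
  have hFeq : F = C F.leadingCoeff * X ^ n := by
    conv_lhs => rw [hFP]
    have hrep := Multiset.eq_replicate_of_mem hall
    have hcn' : F.roots.card = n := by exact_mod_cast hcn
    rw [show P = X ^ n by simp only [P]; rw [hrep]; simp [hcn']]
  apply hG0
  ext j
  rw [coeff_qDeltaStar, hFeq, coeff_C_mul, coeff_X_pow]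
  split_ifs with hj
  · rw [hj, qDeltaStarWeight_self hn]
    simp
  · simp

lemma strictLogSep_qDeltaStar_one {n : ℕ} (hn : 1 ≤ n) {F : ℝ[X]} (hF : F.Splits)
    (hdeg : F.natDegree ≤ n) (hsep : StrictLogSep 1 F.roots) :
    StrictLogSep 1 (qDeltaStar 1 n F).roots := by
  by_cases hG0 : qDeltaStar 1 n F = 0
  · rw [hG0]
    simp [StrictLogSep]
  rw [strictLogSep_one_iff] at hsep ⊢
  intro x hx hx0
  by_contra! hcount
  rw [count_roots] at hcount
  obtain ⟨h1, h2⟩ := (one_lt_rootMultiplicity_iff_isRoot hG0).1 hcount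
  have hFx := eval_eq_zero_of_double_zero_qDeltaStar_one hn hF hdeg hG0 hx0 h1 h2
  have hF0 : F ≠ 0 := by
    rintro rfl
    exact hG0 (by ext j; rw [coeff_qDeltaStar]; simp)
  have hF' : (derivative F).eval x = 0 := by
    have hn0 : (n : ℝ) ≠ 0 := by positivity
    rw [IsRoot, qDeltaStar, if_pos rfl] at h1
    simpa [hFx, hn0, hx0] using h1
  have := (one_lt_rootMultiplicity_iff_isRoot hF0).2 ⟨hFx, hF'⟩
  have := hsep x ((mem_roots hF0).2 hFx) hx0
  rw [count_roots] at this
  omega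

lemma coeff_prod_X_sub_C_nonneg (s : Multiset ℝ) (hs : ∀ r ∈ s, r ≤ 0) (j : ℕ) :
    0 ≤ ((s.map fun r => X - C r).prod).coeff j := by
  induction s using Multiset.induction generalizing j with
  | empty =>
    simp only [Multiset.map_zero, Multiset.prod_zero, coeff_one]
    split_ifs <;> norm_num
  | cons r s ih =>
    have ih' := ih fun x hx => hs x (Multiset.mem_cons_of_mem hx)
    have hr := hs r (Multiset.mem_cons_self r s)
    rw [Multiset.map_cons, Multiset.prod_cons, sub_mul, coeff_sub, coeff_C_mul]
    have h1 := mul_nonneg (neg_nonneg.2 hr) (ih' j)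
    cases j with
    | zero => rw [coeff_X_mul_zero]; linarith
    | succ j => rw [coeff_X_mul]; linarith [ih' j]

lemma onlyNonposRoots_qDeltaStar {q : ℝ} {n : ℕ} (hq0 : 0 < q) (hq1 : q ≤ 1) (hn : 1 ≤ n)
    {F : ℝ[X]} (hF : F.Splits) (hdeg : F.natDegree ≤ n) (hneg : OnlyNonposRoots F) :
    OnlyNonposRoots (qDeltaStar q n F) := by
  intro x hx
  by_contra! hx0
  have hG0 := ne_zero_of_mem_roots hx
  have hGx : (qDeltaStar q n F).eval x = 0 := (mem_roots hG0).1 hx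
  have hcoeff : ∀ j, 0 ≤ F.leadingCoeff * (qDeltaStar q n F).coeff j := by
    intro j
    rw [coeff_qDeltaStar]
    rcases le_or_gt j n with h | h
    · have h1 := qDeltaStarWeight_nonneg hq0 hq1 hn h
      have h2 := coeff_prod_X_sub_C_nonneg F.roots hneg j
      have h3 : F.coeff j = F.leadingCoeff * ((F.roots.map fun r => X - C r).prod).coeff j := by
        conv_lhs => rw [hF.eq_prod_roots, coeff_C_mul]
      rw [h3]
      have := mul_nonneg (mul_nonneg h1 h2) (sq_nonneg F.leadingCoeff)
      linarith
    · rw [coeff_eq_zero_of_natDegree_lt (by omega)]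
      simp
  have hF0 : F ≠ 0 := by
    rintro rfl
    exact hG0 (by ext j; rw [coeff_qDeltaStar]; simp)
  have hsum : ∑ j ∈ Finset.range ((qDeltaStar q n F).natDegree + 1),
      F.leadingCoeff * (qDeltaStar q n F).coeff j * x ^ j = 0 := by
    have := congrArg (F.leadingCoeff * ·) hGx
    simpa [eval_eq_sum_range, Finset.mul_sum, mul_assoc] using this
  rw [Finset.sum_eq_zero_iff_of_nonneg fun j _ => mul_nonneg (hcoeff j) (pow_nonneg hx0.le j)]
    at hsum
  have := hsum _ (Finset.self_mem_range_succ _)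
  rw [mul_eq_zero, mul_eq_zero] at this
  rcases this with (h | h) | h
  · exact hF0 (leadingCoeff_eq_zero.1 h)
  · exact hG0 (leadingCoeff_eq_zero.1 h)
  · exact (pow_pos hx0 _).ne' h

lemma realRooted_iff_splits {F : ℝ[X]} : RealRooted F ↔ F.Splits := by
  rw [splits_iff_card_roots, RealRooted, or_iff_right_iff_imp]
  rintro rfl
  simp

lemma memRbar_qDeltaStar {n : ℕ} (hn : 1 ≤ n) {q : ℝ} (hq0 : 0 < q) (hq1 : q ≤ 1) {F : ℝ[X]}
    (h : memRbar n q F) : memRbar n q (qDeltaStar q n F) := by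
  obtain ⟨hdeg, hreal, hsep⟩ := h
  refine ⟨(natDegree_qDeltaStar_le q n F).trans hdeg, ?_⟩
  rw [realRooted_iff_splits] at hreal ⊢
  rcases hq1.eq_or_lt with rfl | hlt
  · exact ⟨splits_qDeltaStar_one hn hreal hdeg, logSep_one _⟩
  · by_cases hG0 : qDeltaStar q n F = 0
    · rw [hG0]
      exact ⟨Splits.zero, by simp [LogSep]⟩
    · obtain ⟨h1, h2, -⟩ := qDeltaStar_of_lt_one hn hq0 hlt hdeg
        hreal.natDegree_eq_card_roots.symm hsep hG0
      exact ⟨splits_iff_card_roots.2 h1, h2⟩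

lemma StrictLogSep.logSep {q : ℝ} {s : Multiset ℝ} (h : StrictLogSep q s) : LogSep q s :=
  ⟨fun x hx hx0 hc => (h.1 x hx hx0 hc).le, fun x hx y hy hxy => (h.2 x hx y hy hxy).le⟩

lemma memR_qDeltaStar {n : ℕ} (hn : 1 ≤ n) {q : ℝ} (hq0 : 0 < q) (hq1 : q ≤ 1) {F : ℝ[X]}
    (h : memR n q F) : memR n q (qDeltaStar q n F) := by
  obtain ⟨hdeg, hreal, hsep⟩ := h
  obtain ⟨hdeg', hreal', -⟩ := memRbar_qDeltaStar hn hq0 hq1 ⟨hdeg, hreal, hsep.logSep⟩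
  refine ⟨hdeg', hreal', ?_⟩
  rw [realRooted_iff_splits] at hreal
  rcases hq1.eq_or_lt with rfl | hlt
  · exact strictLogSep_qDeltaStar_one hn hreal hdeg hsep
  · by_cases hG0 : qDeltaStar q n F = 0
    · rw [hG0]
      simp [StrictLogSep]
    · exact (qDeltaStar_of_lt_one hn hq0 hlt hdeg hreal.natDegree_eq_card_roots.symm
        hsep.logSep hG0).2.2 hsep

end

/-- each of the classes `𝓡̄_n(q)`, `𝓡_n(q)`, `𝓝̄_n(q)`, `𝓝_n(q)` is
preserved by `Δ*_{q,n}`. -/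
theorem stmt5 (n : ℕ) (hn : 1 ≤ n) (q : ℝ) (hq0 : 0 < q) (hq1 : q ≤ 1)
    (F : Polynomial ℝ) :
    (memRbar n q F → memRbar n q (qDeltaStar q n F)) ∧
    (memR n q F → memR n q (qDeltaStar q n F)) ∧
    (memNbar n q F → memNbar n q (qDeltaStar q n F)) ∧
    (memN n q F → memN n q (qDeltaStar q n F)) := by
  refine ⟨memRbar_qDeltaStar hn hq0 hq1, memR_qDeltaStar hn hq0 hq1, fun h => ?_, fun h => ?_⟩
  · exact ⟨memRbar_qDeltaStar hn hq0 hq1 h.1, onlyNonposRoots_qDeltaStar hq0 hq1 hn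
      (realRooted_iff_splits.1 h.1.2.1) h.1.1 h.2⟩
  · exact ⟨memR_qDeltaStar hn hq0 hq1 h.1, onlyNonposRoots_qDeltaStar hq0 hq1 hn
      (realRooted_iff_splits.1 h.1.2.1) h.1.1 h.2⟩
end

section
/- (Converse of the q-Newton inequalities) Let n ∈ ℕ and f(z) = ∑_{k=0}^n a_k z^k a real polynomial. If f ∈ 𝓛𝓒_n, then there exists q ∈ (0,1] such that ∑_{k=0}^n C_k^n(q) a_k z^k belongs to 𝓡_n(q). If f ∈ 𝓛𝓒_n⁺, then there exists q ∈ (0,1] such that ∑_{k=0}^n C_k^n(q) a_k z^k belongs to 𝓝_n(q). -/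
open Polynomial Filter

open scoped Classical

noncomputable section

lemma Rpoly_succ_coeff_succ (n j : ℕ) (q : ℝ) :
    (Rpoly (n + 1) q).coeff (j + 1) = (Rpoly n q).coeff (j + 1) + q ^ n * (Rpoly n q).coeff j := by
  have h : Rpoly (n + 1) q = Rpoly n q + C (q ^ n) * Rpoly n q * X := by
    simp only [Rpoly, Finset.prod_range_succ]
    ring
  rw [h, coeff_add, coeff_mul_X, coeff_C_mul]

lemma Rpoly_coeff_zero (n : ℕ) (q : ℝ) : (Rpoly n q).coeff 0 = 1 := by
  simp [coeff_zero_eq_eval_zero, Rpoly, eval_prod]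

lemma Rpoly_coeff_eq_zero {n j : ℕ} (h : n < j) (q : ℝ) : (Rpoly n q).coeff j = 0 := by
  induction n generalizing j with
  | zero => simp [Rpoly, coeff_one, h.ne']
  | succ n ih =>
    obtain ⟨j, rfl⟩ : ∃ i, j = i + 1 := ⟨j - 1, by lia⟩
    rw [Rpoly_succ_coeff_succ, ih (by lia), ih (by lia)]
    simp

lemma exists_qBinom_eq_pow_mul {n j : ℕ} (hj : j ≤ n) :
    ∃ h : ℝ → ℝ, Continuous h ∧ h 0 = 1 ∧ ∀ q, qBinom n j q = q ^ j.choose 2 * h q := by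
  unfold qBinom
  induction n generalizing j with
  | zero =>
    obtain rfl : j = 0 := by lia
    exact ⟨fun _ => 1, continuous_const, rfl, fun q => by simp [Rpoly_coeff_zero]⟩
  | succ n ih =>
    rcases j with _ | j
    · exact ⟨fun _ => 1, continuous_const, rfl, fun q => by simp [Rpoly_coeff_zero]⟩
    obtain ⟨h, hc, h0, hh⟩ := ih (j := j) (by lia)
    have hch : (j + 1).choose 2 = j + j.choose 2 := by
      simp [Nat.choose_succ_succ' j 1]
    rcases (show j = n ∨ j < n by lia) with rfl | hlt
    · refine ⟨h, hc, h0, fun q => ?_⟩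
      rw [Rpoly_succ_coeff_succ, Rpoly_coeff_eq_zero (by lia), hh, hch]
      ring
    · obtain ⟨g, gc, g0, hg⟩ := ih (j := j + 1) (by lia)
      refine ⟨fun q => g q + q ^ (n - j) * h q, by fun_prop, ?_, fun q => ?_⟩
      · simp [g0, h0, show n - j ≠ 0 by lia]
      · rw [Rpoly_succ_coeff_succ, hg, hh, hch]
        obtain ⟨d, rfl⟩ := Nat.exists_eq_add_of_lt hlt
        rw [show j + d + 1 - j = d + 1 by lia]
        ring

/-- The polynomial `∑ C_k^n(q) a_k z^k`. -/
def qBinomTransform (n : ℕ) (q : ℝ) (a : ℕ → ℝ) : ℝ[X] :=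
  ∑ k ∈ Finset.range (n + 1), C (qBinom n k q * a k) * X ^ k

lemma qBinomTransform_eval (n : ℕ) (q : ℝ) (a : ℕ → ℝ) (x : ℝ) :
    (qBinomTransform n q a).eval x =
      ∑ k ∈ Finset.range (n + 1), qBinom n k q * a k * x ^ k := by
  simp [qBinomTransform, eval_finsetSum]

lemma qBinomTransform_coeff (n : ℕ) (q : ℝ) (a : ℕ → ℝ) (k : ℕ) :
    (qBinomTransform n q a).coeff k = if k ≤ n then qBinom n k q * a k else 0 := by
  simp only [qBinomTransform, finsetSum_coeff, coeff_C_mul, coeff_X_pow, mul_ite, mul_one, mul_zero,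
    Finset.sum_ite_eq, Finset.mem_range, Nat.lt_succ_iff]

lemma eventually_qBinom_sq_pos (n : ℕ) :
    ∀ᶠ p : ℝ in nhdsWithin 0 (Set.Ioi 0), ∀ k ≤ n, 0 < qBinom n k (p ^ 2) := by
  have key : ∀ k ∈ Finset.range (n + 1),
      ∀ᶠ p : ℝ in nhdsWithin 0 (Set.Ioi 0), 0 < qBinom n k (p ^ 2) := by
    intro k hk
    obtain ⟨h, hc, h0, hh⟩ := exists_qBinom_eq_pow_mul (n := n) (j := k)
      (by simpa [Nat.lt_succ_iff] using hk)
    have hpos : ∀ᶠ p : ℝ in nhds 0, 0 < h (p ^ 2) :=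
      (show Continuous fun p : ℝ => h (p ^ 2) by fun_prop).continuousAt.eventually_const_lt
        (by simp [h0])
    filter_upwards [nhdsWithin_le_nhds hpos, self_mem_nhdsWithin] with p hp hp0
    rw [hh]
    have : 0 < p := hp0
    positivity
  filter_upwards [(Filter.eventually_all_finset _).2 key] with p hp k hk
  exact hp k (by simpa [Nat.lt_succ_iff] using hk)

/-- On the scale given by an edge `[i, j]` of the Newton polygon, only the two terms of index
`i` and `j` survive as `p → 0`. -/
lemma tendsto_qBinomTransform_rescale {n i j : ℕ} (hij : i < j) (hjn : j ≤ n) {a : ℕ → ℝ}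
    (ha : ∀ k, i < k → k < j → a k = 0) (w : ℝ) :
    Tendsto (fun p : ℝ => p ^ (i * j) *
        (qBinomTransform n (p ^ 2) a).eval (w / p ^ (i + j - 1)))
      (nhdsWithin 0 (Set.Ioi 0)) (nhds (a i * w ^ i + a j * w ^ j)) := by
  have hsum : ∑ k ∈ Finset.range (n + 1),
      (if k = i then a i * w ^ i else if k = j then a j * w ^ j else 0)
      = a i * w ^ i + a j * w ^ j := by
    rw [← Finset.sum_subset (s₁ := {i, j})]
    · rw [Finset.sum_pair hij.ne]
      simp [hij.ne']
    · intro k; simp; lia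
    · intro k _ hk
      simp only [Finset.mem_insert, Finset.mem_singleton, not_or] at hk
      simp [hk.1, hk.2]
  rw [← hsum]
  simp_rw [qBinomTransform_eval, Finset.mul_sum]
  refine tendsto_finsetSum _ fun k hk => ?_
  by_cases hmid : i < k ∧ k < j
  · simp [ha k hmid.1 hmid.2, hmid.1.ne', hmid.2.ne]
  obtain ⟨h, hc, h0, hh⟩ := exists_qBinom_eq_pow_mul (n := n) (j := k)
    (by simpa [Nat.lt_succ_iff] using hk)
  obtain ⟨e, he, he0⟩ : ∃ e : ℕ, e + (i + j - 1) * k = 2 * k.choose 2 + i * j ∧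
      (e = 0 ↔ k = i ∨ k = j) := by
    have h2 : 2 * k.choose 2 = k * (k - 1) := by
      rw [Nat.choose_two_right, Nat.mul_div_cancel' (Nat.even_mul_pred_self k).two_dvd]
    rw [h2]
    rcases (show k ≤ i ∨ j ≤ k by lia) with hk' | hk'
    · refine ⟨(i - k) * (j - k), ?_, by rw [mul_eq_zero]; lia⟩
      obtain ⟨c, rfl⟩ := Nat.exists_eq_add_of_le hk'
      obtain ⟨d, rfl⟩ := Nat.exists_eq_add_of_lt hij
      rcases k with _ | k
      · simp
      · simp only [show k + 1 + c - (k + 1) = c by lia,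
          show k + 1 + c + d + 1 - (k + 1) = c + d + 1 by lia,
          show k + 1 + c + (k + 1 + c + d + 1) - 1 = 2 * k + 2 * c + d + 2 by lia,
          Nat.add_sub_cancel]
        ring
    · refine ⟨(k - i) * (k - j), ?_, by rw [mul_eq_zero]; lia⟩
      obtain ⟨d, rfl⟩ := Nat.exists_eq_add_of_lt hij
      obtain ⟨c, rfl⟩ := Nat.exists_eq_add_of_le hk'
      simp only [show i + d + 1 + c - i = d + 1 + c by lia,
          show i + d + 1 + c - (i + d + 1) = c by lia,
          show i + (i + d + 1) - 1 = 2 * i + d by lia,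
          show i + d + 1 + c - 1 = i + d + c by lia]
      ring
  have hlim : Tendsto (fun p : ℝ => p ^ e * h (p ^ 2) * a k * w ^ k)
      (nhdsWithin 0 (Set.Ioi 0)) (nhds ((0 : ℝ) ^ e * h (0 ^ 2) * a k * w ^ k)) :=
    ((show Continuous fun p : ℝ => p ^ e * h (p ^ 2) * a k * w ^ k by fun_prop).tendsto 0).mono_left
      nhdsWithin_le_nhds
  convert hlim.congr' ?_ using 2
  · by_cases hki : k = i
    · subst hki
      simp [he0.2 (Or.inl rfl), h0]
    · by_cases hkj : k = j
      · subst hkj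
        simp [he0.2 (Or.inr rfl), h0, hki]
      · have : e ≠ 0 := fun h => by simpa [hki, hkj] using he0.1 h
        simp [hki, hkj, this]
  · filter_upwards [self_mem_nhdsWithin] with p hp
    have hp : p ≠ 0 := ne_of_gt hp
    rw [hh, div_pow, ← pow_mul p (i + j - 1), ← pow_mul p 2]
    field_simp
    have : p ^ e * p ^ (k * (i + j - 1)) = p ^ (i * j) * p ^ (2 * k.choose 2) := by
      rw [← pow_add, ← pow_add, mul_comm k, he, add_comm]
    linear_combination (h (p ^ 2) * a k * w ^ k) * this

/-- A sign change of the pointwise limit forces zeros of the approximating functions. -/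
lemma eventually_exists_zero_of_hasDerivAt {G : ℝ → ℝ → ℝ} {L : ℝ → ℝ} {w d : ℝ} {f : Filter ℝ}
    (hG : ∀ᶠ p in f, Continuous (G p)) (hL : ∀ v, Tendsto (fun p => G p v) f (nhds (L v)))
    (h0 : L w = 0) (hd : HasDerivAt L d w) (hd0 : d ≠ 0) {U : Set ℝ} (hU : U ∈ nhds w) :
    ∀ᶠ p in f, ∃ v ∈ U, G p v = 0 := by
  obtain ⟨ε, hε, hball⟩ := Metric.mem_nhds_iff.1 hU
  have hslope : ∀ᶠ v in nhdsWithin w {w}ᶜ, 0 < d * slope L w v :=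
    ((hasDerivAt_iff_tendsto_slope.1 hd).const_mul d).eventually_const_lt
      (mul_self_pos.2 hd0)
  rw [eventually_nhdsWithin_iff, Metric.eventually_nhds_iff] at hslope
  obtain ⟨δ, hδ, hs⟩ := hslope
  set η := min ε δ / 2
  have hη : 0 < η := by positivity
  have hηε : η < ε := by have := min_le_left ε δ; simp only [η]; linarith
  have hηδ : η < δ := by have := min_le_right ε δ; simp only [η]; linarith
  have hr : 0 < d * L (w + η) := by
    have := hs (y := w + η) (by simp [abs_of_pos hη, hηδ]) (by simp [hη.ne'])
    rw [slope_def_field, h0] at this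
    have h2 := mul_pos this hη
    have h3 : d * ((L (w + η) - 0) / (w + η - w)) * η = d * L (w + η) := by
      rw [add_sub_cancel_left]; field_simp; ring
    linarith
  have hl : d * L (w - η) < 0 := by
    have := hs (y := w - η) (by simp [abs_of_pos hη, hηδ]) (by simp [hη.ne'])
    rw [slope_def_field, h0] at this
    have h2 := mul_pos this hη
    have h3 : d * ((L (w - η) - 0) / (w - η - w)) * η = - (d * L (w - η)) := by
      rw [show w - η - w = -η by ring]; field_simp; ring
    linarith
  filter_upwards [hG, ((hL (w + η)).const_mul d).eventually_const_lt hr,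
    ((hL (w - η)).const_mul d).eventually_lt_const hl] with p hp h1 h2
  obtain ⟨v, hv, hv0⟩ := intermediate_value_Icc (show w - η ≤ w + η by linarith)
    (f := fun v => d * G p v) (by fun_prop) ⟨h2.le, h1.le⟩
  refine ⟨v, hball ?_, by simpa [hd0] using hv0⟩
  rw [Metric.mem_ball, Real.dist_eq, abs_lt]
  constructor <;> linarith [hv.1, hv.2]

lemma eventually_exists_root_qBinomTransform {n i j : ℕ} (hij : i < j) (hjn : j ≤ n) {a : ℕ → ℝ}
    (ha : ∀ k, i < k → k < j → a k = 0) (hai : a i ≠ 0) {w : ℝ} (hw : w ≠ 0)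
    (hroot : a i + a j * w ^ (j - i) = 0) {U : Set ℝ} (hU : U ∈ nhds w) :
    ∀ᶠ p : ℝ in nhdsWithin 0 (Set.Ioi 0), ∃ v ∈ U,
      (qBinomTransform n (p ^ 2) a).eval (v / p ^ (i + j - 1)) = 0 := by
  have hpow : w ^ j = w ^ i * w ^ (j - i) := by rw [← pow_add]; congr 1; lia
  have hpred : ∀ k : ℕ, (k : ℝ) * w ^ (k - 1) * w = k * w ^ k := by
    intro k
    rcases k with _ | k
    · simp
    · rw [Nat.add_sub_cancel]; ring
  have hderiv : HasDerivAt (fun v : ℝ => a i * v ^ i + a j * v ^ j)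
      (a i * (i * w ^ (i - 1)) + a j * (j * w ^ (j - 1))) w :=
    ((hasDerivAt_pow i w).const_mul _).add ((hasDerivAt_pow j w).const_mul _)
  have hne : a i * (i * w ^ (i - 1)) + a j * (j * w ^ (j - 1)) ≠ 0 := by
    intro h
    have h1 : ((i : ℝ) - j) * (a i * w ^ i) = 0 := by
      linear_combination w * h - a i * hpred i - a j * hpred j - a j * j * hpow
        - j * w ^ i * hroot
    have h2 : (i : ℝ) - j ≠ 0 := sub_ne_zero.2 (by exact_mod_cast hij.ne)
    simp [h2, hai, hw] at h1
  have h := eventually_exists_zero_of_hasDerivAt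
    (G := fun p v => p ^ (i * j) * (qBinomTransform n (p ^ 2) a).eval (v / p ^ (i + j - 1)))
    (Eventually.of_forall fun p => by fun_prop)
    (tendsto_qBinomTransform_rescale hij hjn ha)
    (by linear_combination w ^ i * hroot + a j * hpow) hderiv hne hU
  filter_upwards [h, self_mem_nhdsWithin] with p ⟨v, hv, hv0⟩ hp
  have hp : p ≠ 0 := ne_of_gt hp
  exact ⟨v, hv, by simpa [hp] using hv0⟩

/-- Left endpoint of the Newton polygon edge above `[r, r + 1]`. -/
def edgeLeft (a : ℕ → ℝ) (r : ℕ) : ℕ := if a r = 0 then r - 1 else r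

/-- Right endpoint of the Newton polygon edge above `[r, r + 1]`. -/
def edgeRight (a : ℕ → ℝ) (r : ℕ) : ℕ := if a (r + 1) = 0 then r + 2 else r + 1

/-- The rescaled limit of the root attached to `[r, r + 1]`. An edge of length two carries a
pair of opposite roots. -/
def edgeRoot (a : ℕ → ℝ) (r : ℕ) : ℝ :=
  if a r = 0 then -√(-a (r - 1) / a (r + 1))
  else if a (r + 1) = 0 then √(-a r / a (r + 2))
  else -a r / a (r + 1)

/-- The order of growth of the root attached to `[r, r + 1]`. -/
def edgeSlope (a : ℕ → ℝ) (r : ℕ) : ℕ := edgeLeft a r + edgeRight a r - 1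

/-- Interior form of strict log-concavity on the support `[l, m]`. -/
structure StrictLCOn (a : ℕ → ℝ) (l m : ℕ) : Prop where
  left_ne : a l ≠ 0
  right_ne : a m ≠ 0
  lt_sq : ∀ k, l ≤ k → k + 1 < m → a k * a (k + 2) < a (k + 1) ^ 2

namespace StrictLCOn

variable {a : ℕ → ℝ} {l m r r' : ℕ}

lemma neg_of_eq_zero (h : StrictLCOn a l m) (hl : l ≤ r) (hr : r < m) (h0 : a (r + 1) = 0) :
    r + 2 ≤ m ∧ a r * a (r + 2) < 0 := by
  have hm : r + 1 ≠ m := fun e => h.right_ne (e ▸ h0)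
  have := h.lt_sq r hl (by lia)
  rw [h0] at this
  exact ⟨by lia, by simpa using this⟩

lemma edge_spec (h : StrictLCOn a l m) (hl : l ≤ r) (hr : r < m) :
    edgeLeft a r < edgeRight a r ∧ edgeRight a r ≤ m ∧
    (∀ k, edgeLeft a r < k → k < edgeRight a r → a k = 0) ∧ a (edgeLeft a r) ≠ 0 ∧
    edgeRoot a r ≠ 0 ∧
    a (edgeLeft a r) + a (edgeRight a r) * edgeRoot a r ^ (edgeRight a r - edgeLeft a r) = 0 := by
  have hsq : ∀ x y : ℝ, x * y < 0 → 0 < -x / y ∧ x + y * (-x / y) = 0 := by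
    intro x y hxy
    have hy : y ≠ 0 := by rintro rfl; simp at hxy
    refine ⟨?_, by field_simp; ring⟩
    rw [show -x / y = -(x * y) / y ^ 2 by field_simp]
    have := neg_pos.2 hxy
    positivity
  by_cases h0 : a r = 0
  · have hlr : l ≠ r := fun e => h.left_ne (e ▸ h0)
    obtain ⟨s, rfl⟩ : ∃ s, r = s + 1 := ⟨r - 1, by lia⟩
    obtain ⟨-, hneg⟩ := h.neg_of_eq_zero (by lia) (by lia) h0
    have h1 : a (s + 1 + 1) ≠ 0 := right_ne_zero_of_mul hneg.ne
    obtain ⟨hp, he⟩ := hsq _ _ hneg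
    simp only [edgeLeft, edgeRight, edgeRoot, h0, h1, if_true, if_false, Nat.add_sub_cancel,
      show s + 1 + 1 - s = 2 by lia, neg_sq]
    refine ⟨by lia, by lia, fun k hk hk' => ?_, left_ne_zero_of_mul hneg.ne,
      neg_ne_zero.2 (Real.sqrt_pos.2 hp).ne', ?_⟩
    · rwa [show k = s + 1 by lia]
    · rw [Real.sq_sqrt hp.le, he]
  · by_cases h1 : a (r + 1) = 0
    · obtain ⟨hm, hneg⟩ := h.neg_of_eq_zero hl hr h1
      obtain ⟨hp, he⟩ := hsq _ _ hneg
      simp only [edgeLeft, edgeRight, edgeRoot, h0, h1, if_true, if_false,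
        show r + 2 - r = 2 by lia]
      refine ⟨by lia, hm, fun k hk hk' => ?_, h0, (Real.sqrt_pos.2 hp).ne', ?_⟩
      · rwa [show k = r + 1 by lia]
      · rw [Real.sq_sqrt hp.le, he]
    · simp only [edgeLeft, edgeRight, edgeRoot, h0, h1, if_false, show r + 1 - r = 1 by lia]
      refine ⟨by lia, hr, fun k hk hk' => by lia, h0, by simp [h0, h1], ?_⟩
      field_simp
      ring

lemma edgeRoot_sep (h : StrictLCOn a l m) (hl : l ≤ r) (hrr : r < r') (hr : r' < m)
    (hpos : 0 < edgeRoot a r * edgeRoot a r') :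
    ∃ s, edgeSlope a r' = edgeSlope a r + 2 + s ∧
      (0 : ℝ) ^ s * (edgeRoot a r / edgeRoot a r') < 1 := by
  suffices hs : edgeSlope a r + 3 ≤ edgeSlope a r' ∨ edgeSlope a r' = edgeSlope a r + 2 ∧
      edgeRoot a r / edgeRoot a r' < 1 by
    rcases hs with hs | ⟨hs, hlt⟩
    · obtain ⟨d, hd⟩ := Nat.exists_eq_add_of_le hs
      exact ⟨d + 1, by lia, by simp⟩
    · exact ⟨0, hs, by simpa using hlt⟩
  have hzero : ∀ k, l ≤ k → k < m → a k = 0 → l < k ∧ a (k + 1) ≠ 0 := by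
    intro k hk hk' h0
    have hlk : l ≠ k := fun e => h.left_ne (e ▸ h0)
    obtain ⟨s, rfl⟩ : ∃ s, k = s + 1 := ⟨k - 1, by lia⟩
    exact ⟨by lia, right_ne_zero_of_mul (h.neg_of_eq_zero (by lia) (by lia) h0).2.ne⟩
  have hr0 := hzero r hl (by lia)
  have hr1 := hzero (r + 1) (by lia)
  have hr'0 := hzero r' (by lia) hr
  by_cases h0 : a r = 0
  · left
    obtain ⟨hlt, h1⟩ := hr0 h0
    rcases (show r' = r + 1 ∨ r + 2 ≤ r' by lia) with rfl | hr2
    · simp only [edgeSlope, edgeLeft, edgeRight, h0, h1, if_true, if_false]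
      split_ifs <;> lia
    · simp only [edgeSlope, edgeLeft, edgeRight, h0, h1, if_true, if_false]
      split_ifs <;> lia
  by_cases h1 : a (r + 1) = 0
  · rcases (show r' = r + 1 ∨ r' = r + 2 ∨ r + 3 ≤ r' by lia) with rfl | rfl | hr2
    · exfalso
      simp only [edgeRoot, h0, h1, if_true, if_false, Nat.add_sub_cancel] at hpos
      nlinarith [Real.sqrt_nonneg (-a r / a (r + 2)), Real.sqrt_nonneg (-a r / a (r + 1 + 1))]
    · left
      have h2 : a (r + 2) ≠ 0 := (hr1 (by lia) h1).2
      simp only [edgeSlope, edgeLeft, edgeRight, h0, h1, h2, if_true, if_false]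
      split_ifs <;> lia
    · left
      simp only [edgeSlope, edgeLeft, edgeRight, h0, h1, if_true, if_false]
      split_ifs <;> lia
  · rcases (show r' = r + 1 ∨ r + 2 ≤ r' by lia) with rfl | hr2
    · by_cases h2 : a (r + 1 + 1) = 0
      · left
        simp only [edgeSlope, edgeLeft, edgeRight, h0, h1, h2, if_true, if_false]
        lia
      · right
        simp only [edgeSlope, edgeLeft, edgeRight, edgeRoot, h0, h1, h2, if_false]
        refine ⟨by lia, ?_⟩
        have hlt := h.lt_sq r hl hr
        have e : -a r / a (r + 1) / (-a (r + 1) / a (r + 1 + 1))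
            = a r * a (r + 2) / a (r + 1) ^ 2 := by field_simp
        rw [e, div_lt_one (by positivity)]
        exact hlt
    · left
      simp only [edgeSlope, edgeLeft, edgeRight, h0, h1, if_false]
      split_ifs <;> lia

end StrictLCOn

lemma eventually_scaled_sep {w w' : ℝ} {t t' : ℕ} (hw : w ≠ 0) (hw' : w' ≠ 0)
    (h : 0 < w * w' → ∃ s, t' = t + 2 + s ∧ (0 : ℝ) ^ s * (w / w') < 1) :
    ∀ᶠ z : ℝ × ℝ × ℝ in nhdsWithin 0 (Set.Ioi 0) ×ˢ nhds w ×ˢ nhds w',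
      0 < z.2.1 / z.1 ^ t * (z.2.2 / z.1 ^ t') →
        z.2.1 / z.1 ^ t / (z.2.2 / z.1 ^ t') < z.1 ^ 2 := by
  have hle : nhdsWithin 0 (Set.Ioi 0) ×ˢ nhds w ×ˢ nhds w' ≤ nhds ((0 : ℝ), w, w') := by
    rw [nhds_prod_eq, nhds_prod_eq]
    exact Filter.prod_mono nhdsWithin_le_nhds le_rfl
  have hp : ∀ᶠ z : ℝ × ℝ × ℝ in nhdsWithin 0 (Set.Ioi 0) ×ˢ nhds w ×ˢ nhds w', 0 < z.1 :=
    tendsto_fst.eventually self_mem_nhdsWithin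
  have hprod : ContinuousAt (fun z : ℝ × ℝ × ℝ => z.2.1 * z.2.2) (0, w, w') := by fun_prop
  rcases (mul_ne_zero hw hw').lt_or_gt with hneg | hpos
  · filter_upwards [hp, hle (hprod.eventually_lt_const hneg)] with z hz hz' hc
    exfalso
    rw [div_mul_div_comm, div_pos_iff_of_pos_right (by positivity)] at hc
    linarith
  · obtain ⟨s, rfl, hs⟩ := h hpos
    have hcont : ContinuousAt (fun z : ℝ × ℝ × ℝ => z.1 ^ s * (z.2.1 / z.2.2)) (0, w, w') := by
      have : ContinuousAt (fun z : ℝ × ℝ × ℝ => z.2.1 / z.2.2) (0, w, w') :=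
        ContinuousAt.div (by fun_prop) (by fun_prop) hw'
      fun_prop
    filter_upwards [hp, hle (hcont.eventually_lt_const hs), hle (hprod.eventually_const_lt hpos)]
      with z hz hz' hz0 _
    have h2 : z.2.2 ≠ 0 := right_ne_zero_of_mul hz0.ne'
    have e : z.2.1 / z.1 ^ t / (z.2.2 / z.1 ^ (t + 2 + s))
        = z.1 ^ 2 * (z.1 ^ s * (z.2.1 / z.2.2)) := by
      field_simp
      ring
    rw [e]
    exact mul_lt_of_lt_one_right (by positivity) hz'

lemma StrictLCOn.eventually_exists_separated_roots {a : ℕ → ℝ} {l m n : ℕ}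
    (h : StrictLCOn a l m) (hmn : m ≤ n) :
    ∀ᶠ p : ℝ in nhdsWithin 0 (Set.Ioi 0), ∃ x : ℕ → ℝ,
      (∀ r, l ≤ r → r < m → x r ≠ 0 ∧ (qBinomTransform n (p ^ 2) a).eval (x r) = 0) ∧
      ∀ r r', l ≤ r → r < r' → r' < m → 0 < x r * x r' → x r / x r' < p ^ 2 := by
  set w := edgeRoot a
  set t := edgeSlope a
  have hev : ∀ᶠ z : ℝ × (ℕ → ℝ) in nhdsWithin 0 (Set.Ioi 0) ×ˢ nhds w,
      ∀ r ∈ Finset.Ico l m, z.2 r ≠ 0 ∧ ∀ r' ∈ Finset.Ico l m, r < r' →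
        0 < z.2 r / z.1 ^ t r * (z.2 r' / z.1 ^ t r') →
        z.2 r / z.1 ^ t r / (z.2 r' / z.1 ^ t r') < z.1 ^ 2 := by
    have happ : ∀ r, Tendsto (fun z : ℝ × (ℕ → ℝ) => z.2 r)
        (nhdsWithin 0 (Set.Ioi 0) ×ˢ nhds w) (nhds (w r)) := fun r =>
      ((continuous_apply r).tendsto w).comp tendsto_snd
    refine (Filter.eventually_all_finset _).2 fun r hr => ?_
    rw [Finset.mem_Ico] at hr
    have hw := (h.edge_spec hr.1 hr.2).2.2.2.2.1
    refine ((happ r).eventually_ne hw).and ((Filter.eventually_all_finset _).2 fun r' hr' => ?_)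
    rw [Finset.mem_Ico] at hr'
    refine Filter.eventually_imp_distrib_left.2 fun hlt => ?_
    exact (tendsto_fst.prodMk ((happ r).prodMk (happ r'))).eventually
      (eventually_scaled_sep hw (h.edge_spec hr'.1 hr'.2).2.2.2.2.1
        (h.edgeRoot_sep hr.1 hlt hr'.2))
  obtain ⟨P, hP, Q, hQ, hPQ⟩ := Filter.eventually_prod_iff.1 hev
  rw [Filter.Eventually, nhds_pi, Filter.mem_pi] at hQ
  obtain ⟨I, -, U, hU, hsub⟩ := hQ
  have hroots : ∀ᶠ p : ℝ in nhdsWithin 0 (Set.Ioi 0), ∀ r ∈ Finset.Ico l m, ∃ v ∈ U r,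
      (qBinomTransform n (p ^ 2) a).eval (v / p ^ t r) = 0 := by
    refine (Filter.eventually_all_finset _).2 fun r hr => ?_
    rw [Finset.mem_Ico] at hr
    obtain ⟨h1, h2, h3, h4, h5, h6⟩ := h.edge_spec hr.1 hr.2
    exact eventually_exists_root_qBinomTransform h1 (h2.trans hmn) h3 h4 h5 h6 (hU r)
  filter_upwards [hP, hroots, self_mem_nhdsWithin] with p hp hr hp0
  have hp0 : 0 < p := hp0
  choose! v hvU hv using hr
  set u : ℕ → ℝ := fun r => if r ∈ Finset.Ico l m then v r else w r with hu
  have huU : Q u := hsub fun r _ => by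
    by_cases hr : r ∈ Finset.Ico l m
    · simpa only [hu, if_pos hr] using hvU r hr
    · simpa only [hu, if_neg hr] using mem_of_mem_nhds (hU r)
  have key := hPQ hp huU
  refine ⟨fun r => u r / p ^ t r, fun r hl hm => ?_, fun r r' hl hrr hm => ?_⟩
  · have hr : r ∈ Finset.Ico l m := Finset.mem_Ico.2 ⟨hl, hm⟩
    refine ⟨div_ne_zero (key r hr).1 (by positivity), ?_⟩
    simpa only [hu, if_pos hr] using hv r hr
  · exact (key r (Finset.mem_Ico.2 ⟨hl, by lia⟩)).2 r' (Finset.mem_Ico.2 ⟨by lia, hm⟩) hrr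

lemma roots_eq_of_card_le {F : ℝ[X]} (hF : F ≠ 0) {l m : ℕ} {S : Finset ℝ}
    (hdvd : X ^ l ∣ F) (hdeg : F.natDegree ≤ m) (hS0 : (0 : ℝ) ∉ S)
    (hS : ∀ x ∈ S, F.eval x = 0) (hcard : m ≤ l + S.card) :
    F.roots.card = F.natDegree ∧ F.roots = Multiset.replicate l 0 + S.val := by
  have hle : Multiset.replicate l 0 + S.val ≤ F.roots := by
    rw [Multiset.le_iff_count]
    intro x
    rw [Multiset.count_add, Multiset.count_replicate, count_roots]
    by_cases hx : x = 0
    · subst hx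
      rw [if_pos rfl, Multiset.count_eq_zero_of_notMem hS0, add_zero,
        le_rootMultiplicity_iff hF]
      simpa using hdvd
    · rw [if_neg (Ne.symm hx), zero_add]
      by_cases hxS : x ∈ S
      · exact (Multiset.nodup_iff_count_le_one.1 S.nodup x).trans
          ((rootMultiplicity_pos hF).2 (hS x hxS))
      · rw [Multiset.count_eq_zero_of_notMem hxS]
        exact Nat.zero_le _
  have hc : (Multiset.replicate l (0 : ℝ) + S.val).card = l + S.card := by simp
  have h1 := Multiset.card_le_card hle
  have h2 := card_roots' F
  exact ⟨by lia, (Multiset.eq_of_le_of_card_le hle (by lia)).symm⟩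

lemma StrictLCOn.exists_memR {a : ℕ → ℝ} {l m n : ℕ} (h : StrictLCOn a l m)
    (hmn : m ≤ n) (hl : ∀ k < l, a k = 0) (hm : ∀ k, m < k → a k = 0) :
    ∃ q : ℝ, 0 < q ∧ q ≤ 1 ∧ memR n q (qBinomTransform n q a) ∧ ∀ k ≤ n, 0 < qBinom n k q := by
  have hlt1 : ∀ᶠ p : ℝ in nhdsWithin 0 (Set.Ioi 0), p < 1 :=
    nhdsWithin_le_nhds (eventually_lt_nhds one_pos)
  obtain ⟨p, ⟨⟨x, hx, hsep⟩, hpos, hp1⟩, hp0 : 0 < p⟩ :=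
    (((h.eventually_exists_separated_roots hmn).and
      ((eventually_qBinom_sq_pos n).and hlt1)).and self_mem_nhdsWithin).exists
  have hq1 : p ^ 2 < 1 := by nlinarith
  refine ⟨p ^ 2, by positivity, hq1.le, ?_, hpos⟩
  set F := qBinomTransform n (p ^ 2) a with hFdef
  have hF : F ≠ 0 := fun h0 => by
    have := qBinomTransform_coeff n (p ^ 2) a m
    rw [← hFdef, h0, coeff_zero, if_pos hmn] at this
    exact mul_ne_zero (hpos m hmn).ne' h.right_ne this.symm
  have hdeg : F.natDegree ≤ m := natDegree_le_iff_coeff_eq_zero.2 fun k hk => by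
    rw [qBinomTransform_coeff, hm k hk]; simp
  have hdvd : X ^ l ∣ F := X_pow_dvd_iff.2 fun k hk => by
    rw [qBinomTransform_coeff, hl k hk]; simp
  have hne : ∀ r r', l ≤ r → r < r' → r' < m → x r ≠ x r' := fun r r' h1 h2 h3 he => by
    have h0 := (hx r h1 (by lia)).1
    have := hsep r r' h1 h2 h3 (by rw [← he]; exact mul_self_pos.2 h0)
    rw [← he, div_self h0] at this
    linarith
  have hinj : Set.InjOn x (Finset.Ico l m) := fun r hr r' hr' he => by
    rw [Finset.mem_coe, Finset.mem_Ico] at hr hr'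
    by_contra hrr
    rcases Nat.lt_or_gt_of_ne hrr with hlt | hlt
    · exact hne r r' hr.1 hlt hr'.2 he
    · exact hne r' r hr'.1 hlt hr.2 he.symm
  have hS0 : (0 : ℝ) ∉ (Finset.Ico l m).image x := fun h0 => by
    obtain ⟨r, hr, hr0⟩ := Finset.mem_image.1 h0
    rw [Finset.mem_Ico] at hr
    exact (hx r hr.1 hr.2).1 hr0
  obtain ⟨hcard, hroots⟩ := roots_eq_of_card_le hF (S := (Finset.Ico l m).image x) hdvd hdeg hS0
    (fun y hy => by
      obtain ⟨r, hr, rfl⟩ := Finset.mem_image.1 hy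
      rw [Finset.mem_Ico] at hr
      exact (hx r hr.1 hr.2).2)
    (by rw [Finset.card_image_of_injOn hinj, Nat.card_Ico]; lia)
  have hmem : ∀ y ∈ F.roots, y ≠ 0 → ∃ r, l ≤ r ∧ r < m ∧ x r = y := fun y hy hy0 => by
    rw [hroots, Multiset.mem_add, Multiset.mem_replicate, Finset.mem_val, Finset.mem_image] at hy
    obtain ⟨r, hr, he⟩ := hy.resolve_left fun h => hy0 h.2
    rw [Finset.mem_Ico] at hr
    exact ⟨r, hr.1, hr.2, he⟩
  refine ⟨hdeg.trans hmn, Or.inr hcard, fun y _ hy0 hy2 => ?_, fun y hy z hz hyz => ?_⟩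
  · rw [hroots, Multiset.count_add, Multiset.count_replicate, if_neg (Ne.symm hy0), zero_add] at hy2
    have := Multiset.nodup_iff_count_le_one.1 ((Finset.Ico l m).image x).nodup y
    lia
  · have hyz0 : 0 < y * z := by
      rcases hyz with ⟨h1, h2⟩ | ⟨h1, h2⟩
      · exact mul_pos_of_neg_of_neg h2 (h1.trans h2)
      · exact mul_pos h1 (h1.trans h2)
    have hzy : 1 < z / y := by
      rcases hyz with ⟨h1, h2⟩ | ⟨h1, h2⟩
      · rwa [one_lt_div_of_neg h2]
      · rwa [one_lt_div h1]
    obtain ⟨r, hr, hr', rfl⟩ := hmem y hy (left_ne_zero_of_mul hyz0.ne')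
    obtain ⟨s, hs, hs', rfl⟩ := hmem z hz (right_ne_zero_of_mul hyz0.ne')
    rcases lt_trichotomy r s with hlt | rfl | hlt
    · exact hsep r s hr hlt hs' hyz0
    · rcases hyz with ⟨h1, -⟩ | ⟨-, h1⟩ <;> exact absurd h1 (lt_irrefl _)
    · have := hsep s r hs hlt hr' (by rwa [mul_comm])
      linarith

lemma LCcond.exists_strictLCOn {n : ℕ} {a : ℕ → ℝ} (ha : ∀ k, n < k → a k = 0)
    (h : LCcond n a) (h0 : ∃ k, a k ≠ 0) :
    ∃ l m, StrictLCOn a l m ∧ m ≤ n ∧ (∀ k < l, a k = 0) ∧ ∀ k, m < k → a k = 0 := by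
  have hb : ∀ k, a k ≠ 0 → k ≤ n := fun k hk => by
    by_contra hkn
    exact hk (ha k (by lia))
  obtain ⟨k₀, hk₀⟩ := h0
  have hm : a (Nat.findGreatest (fun k => a k ≠ 0) n) ≠ 0 :=
    Nat.findGreatest_spec (P := fun k => a k ≠ 0) (hb k₀ hk₀) hk₀
  have hle : ∀ k, a k ≠ 0 → k ≤ Nat.findGreatest (fun k => a k ≠ 0) n := fun k hk =>
    Nat.le_findGreatest (hb k hk) hk
  have hl := Nat.find_spec (⟨k₀, hk₀⟩ : ∃ k, a k ≠ 0)
  refine ⟨Nat.find (⟨k₀, hk₀⟩ : ∃ k, a k ≠ 0), Nat.findGreatest (fun k => a k ≠ 0) n,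
    ⟨hl, hm, fun k hk hk' => ?_⟩, Nat.findGreatest_le n,
    fun k hk => not_not.1 (Nat.find_min _ hk), fun k hk => ?_⟩
  · have hmn := Nat.findGreatest_le (P := fun k => a k ≠ 0) n
    simpa using h (k + 1) (by lia) ⟨_, by lia, hl⟩ ⟨_, by lia, hmn, hm⟩
  · by_contra hne
    have := hle k hne
    lia

lemma LCcond.exists_memR {n : ℕ} {a : ℕ → ℝ} (ha : ∀ k, n < k → a k = 0) (h : LCcond n a) :
    ∃ q : ℝ, 0 < q ∧ q ≤ 1 ∧ memR n q (qBinomTransform n q a) ∧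
      ((∃ k, a k ≠ 0) → ∀ k ≤ n, 0 < qBinom n k q) := by
  by_cases h0 : ∃ k, a k ≠ 0
  · obtain ⟨l, m, hlc, hmn, hl, hm⟩ := h.exists_strictLCOn ha h0
    obtain ⟨q, hq, hq1, hR, hpos⟩ := hlc.exists_memR hmn hl hm
    exact ⟨q, hq, hq1, hR, fun _ => hpos⟩
  · refine ⟨1, one_pos, le_rfl, ?_, fun h => absurd h h0⟩
    push Not at h0
    have : qBinomTransform n 1 a = 0 := by simp [qBinomTransform, h0]
    rw [this]
    exact ⟨by simp, Or.inl rfl, by simp [StrictLogSep]⟩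

lemma qBinomTransform_eval_pos {n k : ℕ} {q x : ℝ} {a : ℕ → ℝ} (hq : ∀ k ≤ n, 0 < qBinom n k q)
    (ha : ∀ k, 0 ≤ a k) (hk : k ≤ n) (hak : a k ≠ 0) (hx : 0 < x) :
    0 < (qBinomTransform n q a).eval x := by
  rw [qBinomTransform_eval]
  refine Finset.sum_pos' (fun i hi => ?_) ⟨k, by simp; lia, ?_⟩
  · exact mul_nonneg (mul_nonneg (hq i (by simp at hi; lia)).le (ha i)) (by positivity)
  · exact mul_pos (mul_pos (hq k hk) ((ha k).lt_of_ne' hak)) (by positivity)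

lemma onlyNonposRoots_qBinomTransform {n : ℕ} {q : ℝ} {a : ℕ → ℝ} (ha : ∀ k, n < k → a k = 0)
    (hq : (∃ k, a k ≠ 0) → ∀ k ≤ n, 0 < qBinom n k q)
    (hs : (∀ k, 0 ≤ a k) ∨ (∀ k, a k ≤ 0)) : OnlyNonposRoots (qBinomTransform n q a) := by
  intro x hx
  by_cases h0 : ∃ k, a k ≠ 0
  · obtain ⟨k, hk⟩ := h0
    have hkn : k ≤ n := by
      by_contra hkn
      exact hk (ha k (by lia))
    by_contra! hx0
    have hroot : (qBinomTransform n q a).eval x = 0 := (mem_roots'.1 hx).2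
    rcases hs with hs | hs
    · exact (qBinomTransform_eval_pos (hq ⟨k, hk⟩) hs hkn hk hx0).ne' hroot
    · have := qBinomTransform_eval_pos (a := fun k => -a k) (hq ⟨k, hk⟩)
        (fun k => neg_nonneg.2 (hs k)) hkn (neg_ne_zero.2 hk) hx0
      rw [qBinomTransform_eval] at this hroot
      simp only [mul_neg, neg_mul, Finset.sum_neg_distrib, hroot, neg_zero, lt_irrefl] at this
  · push Not at h0
    simp [qBinomTransform, h0] at hx

end

/-- converse of the q-Newton inequalities. -/
theorem stmt8 (n : ℕ) (hn : 1 ≤ n) (a : ℕ → ℝ) (ha : ∀ k, n < k → a k = 0) :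
    (LCcond n a → ∃ q : ℝ, 0 < q ∧ q ≤ 1 ∧
      memR n q (∑ k ∈ Finset.range (n + 1),
        Polynomial.C (qBinom n k q * a k) * Polynomial.X ^ k)) ∧
    ((LCcond n a ∧ ((∀ k, 0 ≤ a k) ∨ (∀ k, a k ≤ 0))) → ∃ q : ℝ, 0 < q ∧ q ≤ 1 ∧
      memN n q (∑ k ∈ Finset.range (n + 1),
        Polynomial.C (qBinom n k q * a k) * Polynomial.X ^ k)) := by
  refine ⟨fun h => ?_, fun ⟨h, hs⟩ => ?_⟩
  · obtain ⟨q, hq, hq1, hR, -⟩ := h.exists_memR ha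
    exact ⟨q, hq, hq1, hR⟩
  · obtain ⟨q, hq, hq1, hR, hpos⟩ := h.exists_memR ha
    exact ⟨q, hq, hq1, hR, onlyNonposRoots_qBinomTransform ha hpos hs⟩
end

section
/- Let F be a real polynomial of degree n ∈ ℕ₀ with only real, simple zeros y_1, …, y_n, and let G be a nonzero real polynomial of degree ≤ n+1. Write the partial fraction decomposition G(z)/F(z) = −c_∞ z + c_0 + ∑_{k=1}^n c_{y_k}/(z − y_k) with real constants c_∞, c_0, c_{y_1}, …, c_{y_n} (so that G = c_∞·(−zF) + c_0·F + ∑_k c_{y_k}·F/(z − y_k)). Then: (a) c_∞ ≠ 0 if and only if deg G = n+1, and c_{y_k} = 0 if and only if G(y_k) = 0; (b) F ≼ G if and only if c_∞ ≤ 0 and c_{y_k} ≤ 0 for all k; (c) F ≺ G if and only if c_∞ ≤ 0 and c_{y_k} < 0 for all k. -/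
open Polynomial Filter

open scoped Classical

/-- A root of `F` whose multiplicity is one is not a root of `F / (X - C y)`. -/
theorem eval_div_X_sub_C_ne_zero {F : Polynomial ℝ} (hF : F ≠ 0) {y : ℝ} (hy : F.IsRoot y)
    (hmult : F.rootMultiplicity y = 1) : (F / (X - C y)).eval y ≠ 0 := by
  intro h
  have hd : (derivative F).eval y = 0 := by
    rw [← hy.mul_div_eq]
    simp [derivative_mul, h]
  have := (one_lt_rootMultiplicity_iff_isRoot hF).2 ⟨hy, hd⟩
  omega

theorem eval_div_X_sub_C_of_ne {F : Polynomial ℝ} {x y : ℝ} (hx : F.IsRoot x) (hy : F.IsRoot y)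
    (hxy : x ≠ y) : (F / (X - C y)).eval x = 0 := by
  have h : F.eval x = 0 := hx
  rw [← hy.mul_div_eq] at h
  simpa [sub_ne_zero.2 hxy] using h

/-- The Wronskian-type expression `F'G - FG'` for `G` in partial fraction form. -/
theorem wronskian_partialFraction (F : Polynomial ℝ) (s : Finset ℝ) (hs : ∀ y ∈ s, F.IsRoot y)
    (a b : ℝ) (c : ℝ → ℝ) (G : Polynomial ℝ)
    (hG : G = C a * (-(X * F)) + C b * F + ∑ y ∈ s, C (c y) * (F / (X - C y))) :
    derivative F * G - F * derivative G =
      C a * F ^ 2 + ∑ y ∈ s, C (c y) * (F / (X - C y)) ^ 2 := by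
  have key : ∀ y ∈ s, derivative F * (C (c y) * (F / (X - C y))) -
      F * (C (c y) * derivative (F / (X - C y))) = C (c y) * (F / (X - C y)) ^ 2 := by
    intro y hy
    have h := (hs y hy).mul_div_eq
    generalize F / (X - C y) = Q at h ⊢
    rw [← h]
    simp only [derivative_mul, derivative_sub, derivative_X, derivative_C]
    ring
  rw [← Finset.sum_congr rfl key, Finset.sum_sub_distrib, ← Finset.mul_sum, ← Finset.mul_sum, hG]
  simp only [derivative_add, derivative_mul, derivative_neg, derivative_X, derivative_C,
    derivative_sum, zero_mul, zero_add]
  ring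

/-- Nonpositive partial fraction coefficients force all complex zeros to be real. -/
theorem splits_of_partialFraction_nonpos {F : Polynomial ℝ} (hF : F.Splits)
    (s : Finset ℝ) (hs : ∀ y ∈ s, F.IsRoot y) {a b : ℝ} {c : ℝ → ℝ} {G : Polynomial ℝ}
    (hG : G = C a * (-(X * F)) + C b * F + ∑ y ∈ s, C (c y) * (F / (X - C y)))
    (ha : a ≤ 0) (hc : ∀ y ∈ s, c y ≤ 0) (hG0 : G ≠ 0) : G.Splits := by
  by_cases htriv : a = 0 ∧ ∀ y ∈ s, c y = 0
  · have : G = C b * F := by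
      rw [hG, htriv.1, Finset.sum_eq_zero fun y hy => by rw [htriv.2 y hy]; simp]
      simp
    rw [this]
    exact (Splits.C b).mul hF
  refine Splits.of_splits_map (algebraMap ℝ ℂ) (IsAlgClosed.splits _) fun z hz => ?_
  by_contra hzreal
  have him : z.im ≠ 0 := fun h => hzreal ⟨z.re, Complex.ext (by simp) (by simp [h])⟩
  have hGz : aeval z G = 0 := by
    have := isRoot_of_mem_roots hz
    rwa [IsRoot, eval_map_algebraMap] at this
  have hne : ∀ y : ℝ, z - y ≠ 0 := fun y h => him (by simpa using congrArg Complex.im h)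
  by_cases hF0 : F = 0
  · apply hG0
    rw [hG, hF0]
    simp
  have hFz : aeval z F ≠ 0 := by
    intro h
    have := hF.mem_range_of_isRoot (i := algebraMap ℝ ℂ) hF0 (x := z)
      (by rwa [IsRoot, eval_map_algebraMap])
    exact hzreal this
  have hsum : (-(a : ℂ) * z + b + ∑ y ∈ s, (c y : ℂ) * (z - y)⁻¹) = 0 := by
    have h1 : aeval z G =
        aeval z F * (-(a : ℂ) * z + b + ∑ y ∈ s, (c y : ℂ) * (z - y)⁻¹) := by
      have h2 : ∀ y ∈ s, aeval z (F / (X - C y)) = aeval z F * (z - y)⁻¹ := by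
        intro y hy
        rw [eq_mul_inv_iff_mul_eq₀ (hne y)]
        conv_rhs => rw [← (hs y hy).mul_div_eq]
        simp [mul_comm]
      rw [hG]
      simp only [map_add, map_mul, map_neg, map_sum, aeval_X, aeval_C]
      rw [Finset.sum_congr rfl fun y hy => by rw [h2 y hy], mul_add, Finset.mul_sum]
      simp only [Complex.coe_algebraMap]
      congr 1
      · ring
      · exact Finset.sum_congr rfl fun y _ => by ring
    rw [hGz] at h1
    exact (mul_eq_zero.1 h1.symm).resolve_left hFz
  have hIm : z.im * (a + ∑ y ∈ s, c y / Complex.normSq (z - y)) = 0 := by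
    have h := congrArg Complex.im hsum
    simp only [Complex.add_im, Complex.im_sum, Complex.mul_im, Complex.inv_im, Complex.sub_im,
      Complex.ofReal_im, Complex.neg_im, Complex.neg_re, Complex.ofReal_re, Complex.zero_im,
      zero_mul, add_zero, sub_zero, neg_zero] at h
    rw [mul_add, Finset.mul_sum, ← neg_eq_zero, neg_add, ← Finset.sum_neg_distrib, ← h]
    congr 1
    · ring
    · exact Finset.sum_congr rfl fun y _ => by ring
  have hzero := (mul_eq_zero.1 hIm).resolve_left him
  have hpos : ∀ y : ℝ, 0 < Complex.normSq (z - y) := fun y => Complex.normSq_pos.2 (hne y)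
  have hterm : ∀ y ∈ s, c y / Complex.normSq (z - y) ≤ 0 := fun y hy =>
    div_nonpos_of_nonpos_of_nonneg (hc y hy) (hpos y).le
  have hle := Finset.sum_nonpos hterm
  refine htriv ⟨by linarith, fun y hy => ?_⟩
  have := (Finset.sum_eq_zero_iff_of_nonpos hterm).1 (by linarith) y hy
  exact (div_eq_zero_iff.1 this).resolve_right (hpos y).ne'

/-- The coefficient at infinity is the limit of `-(G/F)'`, hence inherits its sign. -/
theorem nonpos_of_eval_partialFraction_nonpos {F : Polynomial ℝ}
    (s : Finset ℝ) (hs : ∀ y ∈ s, F.IsRoot y) (hF : F ≠ 0) {a : ℝ} {c : ℝ → ℝ}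
    (h : ∀ x : ℝ, (C a * F ^ 2 + ∑ y ∈ s, C (c y) * (F / (X - C y)) ^ 2).eval x ≤ 0) :
    a ≤ 0 := by
  have hlim : Tendsto (fun x : ℝ => a + ∑ y ∈ s, c y * ((x - y)⁻¹) ^ 2) atTop
      (nhds (a + ∑ y ∈ s, c y * 0 ^ 2)) := by
    refine tendsto_const_nhds.add (tendsto_finsetSum _ fun y _ => ?_)
    refine Tendsto.const_mul _ (Tendsto.pow ?_ 2)
    exact tendsto_inv_atTop_zero.comp (tendsto_atTop_add_const_right _ (-y) tendsto_id)
  have hlim' : a + ∑ y ∈ s, c y * (0 : ℝ) ^ 2 = a := by simp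
  rw [hlim'] at hlim
  refine le_of_tendsto hlim ?_
  have hev : ∀ᶠ x : ℝ in atTop, ∀ y ∈ F.roots.toFinset, y < x :=
    (Filter.eventually_all_finset _).2 fun y _ => eventually_gt_atTop y
  filter_upwards [hev] with x hx
  have hFx : F.eval x ≠ 0 := fun h0 => lt_irrefl x (hx x (by simpa [hF] using h0))
  have hq : ∀ y ∈ s, (F / (X - C y)).eval x = F.eval x * (x - y)⁻¹ := by
    intro y hy
    have hxy : x - y ≠ 0 := (sub_pos.2 (hx y (by simpa [hF] using hs y hy))).ne'
    rw [eq_mul_inv_iff_mul_eq₀ hxy]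
    conv_rhs => rw [← (hs y hy).mul_div_eq]
    simp [mul_comm]
  have hx' := h x
  have heq : (C a * F ^ 2 + ∑ y ∈ s, C (c y) * (F / (X - C y)) ^ 2).eval x =
      F.eval x ^ 2 * (a + ∑ y ∈ s, c y * ((x - y)⁻¹) ^ 2) := by
    simp only [eval_add, eval_mul, eval_C, eval_pow, eval_finsetSum]
    rw [Finset.sum_congr rfl fun y hy => by rw [hq y hy], mul_add, Finset.mul_sum]
    congr 1
    · ring
    · exact Finset.sum_congr rfl fun y _ => by ring
  rw [heq] at hx'
  exact nonpos_of_mul_nonpos_right hx' (by positivity)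

/-- partial fraction decomposition and characterization of `≼`
and `≺` in terms of the coefficients. -/
theorem stmt11 (n : ℕ) (F G : Polynomial ℝ) (hF : F ≠ 0) (hFdeg : F.natDegree = n)
    (hFreal : F.roots.card = n) (hFsimple : ∀ x ∈ F.roots, F.roots.count x = 1)
    (hG : G ≠ 0) (hGdeg : G.natDegree ≤ n + 1)
    (cinf c0 : ℝ) (c : ℝ → ℝ)
    (hdecomp : G = Polynomial.C cinf * (-(Polynomial.X * F)) + Polynomial.C c0 * F +
      ∑ y ∈ F.roots.toFinset, Polynomial.C (c y) * (F / (Polynomial.X - Polynomial.C y))) :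
    ((cinf ≠ 0 ↔ G.natDegree = n + 1) ∧
      ∀ y ∈ F.roots.toFinset, (c y = 0 ↔ G.eval y = 0)) ∧
    (Prec F G ↔ (cinf ≤ 0 ∧ ∀ y ∈ F.roots.toFinset, c y ≤ 0)) ∧
    (PrecS F G ↔ (cinf ≤ 0 ∧ ∀ y ∈ F.roots.toFinset, c y < 0)) := by
  set s := F.roots.toFinset with hs_def
  have hmem : ∀ {y : ℝ}, y ∈ s ↔ F.IsRoot y := by
    intro y
    simp [hs_def, hF]
  have hs : ∀ y ∈ s, F.IsRoot y := fun y hy => hmem.1 hy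
  have hq : ∀ y ∈ s, (F / (X - C y)).eval y ≠ 0 := fun y hy =>
    eval_div_X_sub_C_ne_zero hF (hs y hy)
      (by rw [← count_roots]; convert hFsimple y (by simpa [hs_def] using hy))
  have hsum : ∀ y ∈ s, ∀ k : ℕ, k ≠ 0 →
      ∑ t ∈ s, c t * (F / (X - C t)).eval y ^ k = c y * (F / (X - C y)).eval y ^ k := by
    intro y hy k hk
    refine Finset.sum_eq_single_of_mem y hy fun t ht hty => ?_
    rw [eval_div_X_sub_C_of_ne (hs y hy) (hs t ht) hty.symm, zero_pow hk, mul_zero]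
  have hGy : ∀ y ∈ s, G.eval y = c y * (F / (X - C y)).eval y := by
    intro y hy
    have h0 : F.eval y = 0 := hs y hy
    have h1 := hsum y hy 1 one_ne_zero
    simp only [pow_one] at h1
    rw [hdecomp]
    simp only [eval_add, eval_mul, eval_neg, eval_C, eval_X, eval_finsetSum, h0, h1]
    ring
  have hcoef : G.coeff (n + 1) = -(cinf * F.leadingCoeff) := by
    have hdiv : ∀ y ∈ s, (F / (X - C y)).coeff (n + 1) = 0 := fun y hy =>
      coeff_eq_zero_of_natDegree_lt (Nat.lt_succ_of_le (hFdeg ▸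
        natDegree_le_of_dvd (Dvd.intro_left _ (hs y hy).mul_div_eq) hF))
    have hF1 : F.coeff (n + 1) = 0 := coeff_eq_zero_of_natDegree_lt (by omega)
    rw [hdecomp]
    simp only [coeff_add, coeff_C_mul, coeff_neg, coeff_X_mul, finsetSum_coeff, hF1]
    rw [Finset.sum_eq_zero fun y hy => by rw [hdiv y hy, mul_zero], leadingCoeff, hFdeg]
    ring
  have hzero : ∀ y ∈ s, (c y = 0 ↔ G.eval y = 0) := by
    intro y hy
    rw [hGy y hy, mul_eq_zero, or_iff_left (hq y hy)]
  have hW := wronskian_partialFraction F s hs cinf c0 c G hdecomp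
  have hPrec : Prec F G ↔ (cinf ≤ 0 ∧ ∀ y ∈ s, c y ≤ 0) := by
    constructor
    · rintro ⟨-, -, h⟩
      rw [hW] at h
      refine ⟨nonpos_of_eval_partialFraction_nonpos s hs hF h, fun y hy => ?_⟩
      have h0 : F.eval y = 0 := hs y hy
      have h1 := h y
      simp only [eval_add, eval_mul, eval_C, eval_pow, eval_finsetSum, h0,
        hsum y hy 2 two_ne_zero] at h1
      have := hq y hy
      exact nonpos_of_mul_nonpos_left (by simpa using h1) (by positivity)
    · rintro ⟨ha, hc⟩
      have hFs : F.Splits := splits_iff_card_roots.2 (hFreal.trans hFdeg.symm)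
      refine ⟨Or.inr (splits_iff_card_roots.1 hFs), Or.inr (splits_iff_card_roots.1
        (splits_of_partialFraction_nonpos hFs s hs hdecomp ha hc hG)), fun x => ?_⟩
      rw [hW]
      simp only [eval_add, eval_mul, eval_C, eval_pow, eval_finsetSum]
      exact add_nonpos (mul_nonpos_of_nonpos_of_nonneg ha (sq_nonneg _))
        (Finset.sum_nonpos fun y hy => mul_nonpos_of_nonpos_of_nonneg (hc y hy) (sq_nonneg _))
  refine ⟨⟨?_, hzero⟩, hPrec, ?_⟩
  · have hlc : F.leadingCoeff ≠ 0 := leadingCoeff_ne_zero.2 hF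
    constructor
    · intro ha
      refine le_antisymm hGdeg (le_natDegree_of_ne_zero ?_)
      rw [hcoef]
      exact neg_ne_zero.2 (mul_ne_zero ha hlc)
    · rintro hd rfl
      rw [zero_mul, neg_zero, ← hd] at hcoef
      exact hG (leadingCoeff_eq_zero.1 hcoef)
  · rw [PrecS, hPrec]
    constructor
    · rintro ⟨⟨ha, hc⟩, hno⟩
      exact ⟨ha, fun y hy => lt_of_le_of_ne (hc y hy) fun h =>
        hno y ⟨hs y hy, (hzero y hy).1 h⟩⟩
    · rintro ⟨ha, hc⟩
      refine ⟨⟨ha, fun y hy => (hc y hy).le⟩, fun x hx => ?_⟩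
      have hxs : x ∈ s := hmem.2 hx.1
      exact (hc x hxs).ne ((hzero x hxs).2 hx.2)
end
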